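/- Let 0 < c₁ ≤ 1 ≤ c₂ and let ρ be a probability density on ℝ with mean zero and unit variance satisfying c₁ g(x) ≤ ρ(x) ≤ c₂ g(x) for all x. Then there exists a constant c with 0 < c < 1, depending only on c₁ and c₂, such that 0 ≤ D(ρ⊛ρ) ≤ (1 − c) D(ρ). -/

import Mathlib

open MeasureTheory Real Set

noncomputable section

/-- The standard Gaussian density on ℝ. -/
def gaussPDF (x : ℝ) : ℝ := (Real.sqrt (2 * Real.pi))⁻¹ * Real.exp (-x ^ 2 / 2)

/-- Convolution of two densities on ℝ. -/
def convDens (f g : ℝ → ℝ) (x : ℝ) : ℝ := ∫ y, f (x - y) * g y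

/-- `iterConv ρ n` is the `(n+1)`-fold convolution of `ρ` with itself. -/
def iterConv (ρ : ℝ → ℝ) : ℕ → ℝ → ℝ
  | 0 => ρ
  | n + 1 => convDens (iterConv ρ n) ρ

/-- `rescaledConv ρ n` is the density of `n^{-1/2}(X₁ + ⋯ + Xₙ)` for i.i.d. `Xⱼ`
with density `ρ`, i.e. `x ↦ √n (ρ∗⋯∗ρ)(√n x)` with the `n`-fold convolution. -/
def rescaledConv (ρ : ℝ → ℝ) (n : ℕ) (x : ℝ) : ℝ :=
  Real.sqrt n * iterConv ρ (n - 1) (Real.sqrt n * x)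

/-- The density of `(X+Y)/√2` for independent `X`, `Y` with densities `ρ`, `η`. -/
def rescaledConvPair (ρ η : ℝ → ℝ) (x : ℝ) : ℝ :=
  Real.sqrt 2 * convDens ρ η (Real.sqrt 2 * x)

/-- The rescaled self-convolution `ρ ⊛ ρ`. -/
def selfConv (ρ : ℝ → ℝ) : ℝ → ℝ := rescaledConvPair ρ ρ

/-- Entropy `S(ρ) = -∫ ρ ln ρ`. -/
def entropy (ρ : ℝ → ℝ) : ℝ := -∫ x, ρ x * Real.log (ρ x)

/-- Relative entropy `D(ρ) = ∫ ρ ln (ρ/g)` with respect to the standard Gaussian. -/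
def relEntropy (ρ : ℝ → ℝ) : ℝ := ∫ x, ρ x * Real.log (ρ x / gaussPDF x)

/-- Fisher information `I(ρ) = 4 ∫ |(√ρ)'|²`. -/
def fisherInfo (ρ : ℝ → ℝ) : ℝ := 4 * ∫ x, (deriv (fun y => Real.sqrt (ρ y)) x) ^ 2

/-- Relative Fisher information `J(ρ) = 4 ∫ |((d/dx) + x/2)√ρ|²`. -/
def relFisher (ρ : ℝ → ℝ) : ℝ :=
  4 * ∫ x, (deriv (fun y => Real.sqrt (ρ y)) x + (x / 2) * Real.sqrt (ρ x)) ^ 2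

/-- The ψ-function `ψ_ρ(R) = ∫_{|x| ≥ R} x² ρ(x) dx`. -/
def psiFun (ρ : ℝ → ℝ) (R : ℝ) : ℝ := ∫ x in {x : ℝ | R ≤ |x|}, x ^ 2 * ρ x

/-- A nonnegative function is log-concave if
`F((1-t)x + ty) ≥ F(x)^{1-t} F(y)^{t}` for `t ∈ [0,1]`. -/
def LogConcaveFun (F : ℝ → ℝ) : Prop :=
  (∀ x, 0 ≤ F x) ∧
  ∀ x y t : ℝ, 0 ≤ t → t ≤ 1 → F x ^ (1 - t) * F y ^ t ≤ F ((1 - t) * x + t * y)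


open ProbabilityTheory Filter Topology

/-- standard Gaussian measure -/
abbrev gam : Measure ℝ := gaussianReal 0 1

/-- its square -/
abbrev gam2 : Measure (ℝ × ℝ) := gam.prod gam

/-- rotation -/
def rot (θ : ℝ) (p : ℝ × ℝ) : ℝ × ℝ :=
  (cos θ * p.1 + sin θ * p.2, -sin θ * p.1 + cos θ * p.2)

lemma rot_cont (θ : ℝ) : Continuous (rot θ) := by unfold rot; fun_prop

lemma rot_rot (θ η : ℝ) (p : ℝ × ℝ) : rot θ (rot η p) = rot (θ + η) p := by
  simp only [rot, cos_add, sin_add]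
  ext <;> simp <;> ring

lemma rot_zero (p : ℝ × ℝ) : rot 0 p = p := by simp [rot]

lemma rot_neg_rot (θ : ℝ) (p : ℝ × ℝ) : rot (-θ) (rot θ p) = p := by
  rw [rot_rot]; simp [rot_zero]

lemma rot_rot_neg (θ : ℝ) (p : ℝ × ℝ) : rot θ (rot (-θ) p) = p := by
  rw [rot_rot]; simp [rot_zero]

lemma rot_emb (θ : ℝ) : MeasurableEmbedding (rot θ) :=
  (rot_cont θ).measurableEmbedding (Function.LeftInverse.injective (rot_neg_rot θ))

lemma rot_mp (θ : ℝ) : MeasurePreserving (rot θ) gam2 gam2 := by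
  refine ⟨(rot_cont θ).measurable, ?_⟩
  have h : ∀ L : StrongDual ℝ ℝ, gam[L] = 0 := by
    intro L
    have : (fun x => L x) = fun x => x * L 1 := by
      ext x
      have := L.map_smul x 1
      simpa using this
    have h2 : ∫ x, L x ∂gam = (∫ x, x ∂gam) * L 1 := by
      rw [this, integral_mul_const]
    rw [h2, integral_id_gaussianReal, zero_mul]
  have := IsGaussian.map_rotation_eq_self_of_forall_strongDual_eq_zero (μ := gam) h θ
  have h3 : (⇑(ContinuousLinearMap.rotation θ) : ℝ × ℝ → ℝ × ℝ) = rot θ := by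
    ext p <;> simp [rot, ContinuousLinearMap.rotation_apply]
  rw [h3] at this
  exact this

lemma integral_rot (θ : ℝ) (h : ℝ × ℝ → ℝ) :
    ∫ p, h (rot θ p) ∂gam2 = ∫ p, h p ∂gam2 :=
  (rot_mp θ).integral_comp (rot_emb θ) h

lemma integrable_rot {θ : ℝ} {h : ℝ × ℝ → ℝ} :
    Integrable (fun p => h (rot θ p)) gam2 ↔ Integrable h gam2 :=
  (rot_mp θ).integrable_comp_emb (rot_emb θ)

lemma gaussPDF_eq : gaussPDF = gaussianPDFReal 0 1 := by
  ext x; simp [gaussPDF, gaussianPDFReal]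

lemma gaussPDF_pos (x : ℝ) : 0 < gaussPDF x := by unfold gaussPDF; positivity

lemma gaussPDF_cont : Continuous gaussPDF := by unfold gaussPDF; fun_prop

lemma gaussPDF_deriv (x : ℝ) : HasDerivAt gaussPDF (-x * gaussPDF x) x := by
  unfold gaussPDF
  have h : HasDerivAt (fun x : ℝ => -x ^ 2 / 2) (-x) x := by
    have := ((hasDerivAt_pow 2 x).neg).div_const 2
    refine this.congr_deriv ?_; simp; ring
  refine ((h.exp).const_mul ((√(2 * π))⁻¹)).congr_deriv ?_
  ring

lemma integral_gam (h : ℝ → ℝ) : ∫ x, h x ∂gam = ∫ x, gaussPDF x * h x := by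
  rw [integral_gaussianReal_eq_integral_smul (by simp), gaussPDF_eq]; rfl

lemma integrable_gam {h : ℝ → ℝ} : Integrable h gam ↔ Integrable (fun x => gaussPDF x * h x) := by
  unfold gam
  rw [gaussianReal_of_var_ne_zero _ (by simp), integrable_withDensity_iff_integrable_smul' 
    (measurable_gaussianPDF _ _) (ae_of_all _ fun _ ↦ gaussianPDF_lt_top), gaussPDF_eq]
  simp

lemma pow_int (n : ℕ) : Integrable (fun x : ℝ => x ^ n) gam := by
  have := (memLp_id_gaussianReal' (μ := 0) (v := 1) n (by simp)).integrable_norm_pow' 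
  have h2 : Integrable (fun x : ℝ => ‖x ^ n‖) gam := by
    simpa [norm_pow] using this
  exact (integrable_norm_iff (by fun_prop)).1 h2

lemma int_x : ∫ x, x ∂gam = 0 := integral_id_gaussianReal

lemma int_x2 : ∫ x, x ^ 2 ∂gam = 1 := by
  have := variance_fun_id_gaussianReal (μ := 0) (v := 1)
  rw [variance_of_integral_eq_zero (by fun_prop) int_x] at this
  simpa using this

lemma intg {h : ℝ → ℝ} (hm : AEStronglyMeasurable h gam) (C : ℝ)
    (hb : ∀ x, |h x| ≤ C * (1 + x ^ 2) ^ 2) : Integrable h gam := by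
  have : Integrable (fun x : ℝ => C * (1 + x ^ 2) ^ 2) gam := by
    have h4 := (((integrable_const 1).add ((pow_int 2).const_mul 2)).add (pow_int 4)).const_mul C
    refine h4.congr (ae_of_all _ fun x => ?_)
    simp only [Pi.add_apply]; ring
  exact this.mono' hm (ae_of_all _ hb)

lemma stein {h h' : ℝ → ℝ} (hd : ∀ x, HasDerivAt h (h' x) x) (i1 : Integrable h gam)
    (i2 : Integrable h' gam) (i3 : Integrable (fun x => x * h x) gam) :
    ∫ x, h' x ∂gam = ∫ x, x * h x ∂gam := by
  have key := integral_eq_zero_of_hasDerivAt_of_integrable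
    (f := fun x => gaussPDF x * h x) (f' := fun x => gaussPDF x * (h' x - x * h x))
    (fun x => by
      refine ((gaussPDF_deriv x).mul (hd x)).congr_deriv ?_; ring)
    (integrable_gam.1 (i2.sub i3)) (integrable_gam.1 i1)
  rw [← integral_gam, integral_sub i2 i3] at key
  linarith

/-- the Gaussian averaging (Ornstein-Uhlenbeck) operator -/
def Pt (θ : ℝ) (f : ℝ → ℝ) (x : ℝ) : ℝ := ∫ y, f (cos θ * x + sin θ * y) ∂gam

/-- `√2/2` -/
def rr : ℝ := √2 / 2

lemma rr_sq : rr ^ 2 = 1 / 2 := by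
  unfold rr; rw [div_pow, Real.sq_sqrt (by norm_num)]; norm_num

lemma rr_pos : 0 < rr := by unfold rr; positivity

/-- rescaled self-convolution at the level of densities w.r.t. the Gaussian -/
def St (f : ℝ → ℝ) (u : ℝ) : ℝ := ∫ v, f (rr * u - rr * v) * f (rr * u + rr * v) ∂gam

lemma rot_r (p : ℝ × ℝ) :
    rot (-(π / 4)) p = (rr * p.1 - rr * p.2, rr * p.1 + rr * p.2) := by
  simp [rot, rr]; ring

lemma bd_int {α : Type*} [MeasurableSpace α] {μ : Measure α} [IsProbabilityMeasure μ]
    {h : α → ℝ} (hm : AEStronglyMeasurable h μ) (C : ℝ) (hb : ∀ x, |h x| ≤ C) : Integrable h μ :=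
  (integrable_const C).mono' hm (ae_of_all _ hb)

lemma bd2_int {α : Type*} [MeasurableSpace α] {μ : Measure α} [IsProbabilityMeasure μ]
    {h : α → ℝ} (hm : AEStronglyMeasurable h μ) {a b : ℝ} (hb : ∀ x, a ≤ h x ∧ h x ≤ b) :
    Integrable h μ :=
  bd_int hm (max |a| |b|) fun x => abs_le_max_abs_abs (hb x).1 (hb x).2

lemma int_bds {α : Type*} [MeasurableSpace α] {μ : Measure α} [IsProbabilityMeasure μ]
    {h : α → ℝ} (hm : AEStronglyMeasurable h μ) {a b : ℝ} (hb : ∀ x, a ≤ h x ∧ h x ≤ b) :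
    a ≤ ∫ x, h x ∂μ ∧ ∫ x, h x ∂μ ≤ b := by
  have hi := bd2_int hm hb
  constructor
  · simpa using integral_mono (integrable_const a) hi (fun x => (hb x).1)
  · simpa using integral_mono hi (integrable_const b) (fun x => (hb x).2)

/-- bounded `C¹` functions with values in `[a,b]` -/
structure Nice (a b : ℝ) (f f' : ℝ → ℝ) : Prop where
  hd : ∀ x, HasDerivAt f (f' x) x
  hc : Continuous f'
  hB : ∃ B, ∀ x, |f' x| ≤ B
  bd : ∀ x, a ≤ f x ∧ f x ≤ b

lemma Nice.cont {a b : ℝ} {f f' : ℝ → ℝ} (h : Nice a b f f') : Continuous f :=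
  continuous_iff_continuousAt.2 fun x => (h.hd x).continuousAt

lemma Nice.deriv_eq {a b : ℝ} {f f' : ℝ → ℝ} (h : Nice a b f f') : deriv f = f' :=
  funext fun x => (h.hd x).deriv

lemma Pt_meas {f : ℝ → ℝ} (hf : Measurable f) (θ : ℝ) : Measurable (Pt θ f) := by
  have : StronglyMeasurable (fun p : ℝ × ℝ => f (cos θ * p.1 + sin θ * p.2)) :=
    (hf.comp (by fun_prop)).stronglyMeasurable
  exact (this.integral_prod_right' (ν := gam)).measurable

lemma St_meas {f : ℝ → ℝ} (hf : Measurable f) : Measurable (St f) := by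
  have : StronglyMeasurable
      (fun p : ℝ × ℝ => f (rr * p.1 - rr * p.2) * f (rr * p.1 + rr * p.2)) :=
    ((hf.comp (by fun_prop)).mul (hf.comp (by fun_prop))).stronglyMeasurable
  exact (this.integral_prod_right' (ν := gam)).measurable

lemma Pt_bd {f : ℝ → ℝ} (hf : Measurable f) {a b : ℝ} (hb : ∀ x, a ≤ f x ∧ f x ≤ b) (θ x : ℝ) :
    a ≤ Pt θ f x ∧ Pt θ f x ≤ b :=
  int_bds (hf.comp (by fun_prop)).aestronglyMeasurable (fun _ => hb _)

lemma St_bd {f : ℝ → ℝ} (hf : Measurable f) {a b : ℝ} (ha : 0 < a)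
    (hb : ∀ x, a ≤ f x ∧ f x ≤ b) (x : ℝ) :
    a ^ 2 ≤ St f x ∧ St f x ≤ b ^ 2 := by
  refine int_bds ((hf.comp (by fun_prop)).mul (hf.comp (by fun_prop))).aestronglyMeasurable 
    (fun v => ?_)
  obtain ⟨h1, h2⟩ := hb (rr * x - rr * v)
  obtain ⟨h3, h4⟩ := hb (rr * x + rr * v)
  simp only [Pi.mul_apply, Function.comp]
  constructor <;> nlinarith

lemma Pt_nice {a b : ℝ} {f f' : ℝ → ℝ} (h : Nice a b f f') (θ : ℝ) :
    Nice a b (Pt θ f) (fun x => cos θ * Pt θ f' x) := by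
  obtain ⟨B, hB⟩ := h.hB
  have hB0 : 0 ≤ B := (abs_nonneg _).trans (hB 0)
  have hfm := h.cont.measurable
  have hfc := h.cont
  have hc := h.hc
  refine ⟨fun x => ?_, ?_, ⟨B, fun x => ?_⟩, fun x => Pt_bd hfm h.bd θ x⟩
  · have := (hasDerivAt_integral_of_dominated_loc_of_deriv_le (μ := gam) (s := univ) (x₀ := x)
      (F := fun x y => f (cos θ * x + sin θ * y))
      (F' := fun x y => cos θ * f' (cos θ * x + sin θ * y)) (bound := fun _ => B)
      univ_mem (.of_forall fun x => (by fun_prop)) 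
      (bd2_int (by fun_prop) (fun y => h.bd _)) (by fun_prop)
      (ae_of_all _ fun y x _ => ?_) (integrable_const _) (ae_of_all _ fun y x _ => ?_)).2
    · simp only [integral_const_mul] at this
      exact this
    · rw [norm_mul, norm_eq_abs, norm_eq_abs]
      exact (mul_le_mul (abs_cos_le_one θ) (hB _) (abs_nonneg _) zero_le_one).trans (by simp)
    · have h1 : HasDerivAt (fun x => cos θ * x + sin θ * y) (cos θ) x := by
        simpa using ((hasDerivAt_id x).const_mul (cos θ)).add_const (sin θ * y)
      have := (h.hd (cos θ * x + sin θ * y)).comp x h1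
      rw [mul_comm (cos θ) (f' _)]; exact this
  · refine continuous_const.mul ?_
    refine continuous_of_dominated (bound := fun _ => B) (fun x => by fun_prop)
      (fun x => ae_of_all _ fun y => hB _) (integrable_const _) (ae_of_all _ fun y => by fun_prop)
  · have := Pt_bd hc.measurable (fun x => abs_le.1 (hB x)) θ x
    rw [abs_mul]
    exact (mul_le_mul (abs_cos_le_one θ) (abs_le.2 this) (abs_nonneg _) zero_le_one).trans (by simp)

lemma Nice.prod_bd {a b : ℝ} {f f' : ℝ → ℝ} (h : Nice a b f f') (ha : 0 < a) {B : ℝ}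
    (hB : ∀ x, |f' x| ≤ B) (x y : ℝ) : |f' x * f y + f x * f' y| ≤ 2 * (B * b) := by
  have e : ∀ x y, |f' x * f y| ≤ B * b := fun x y => by
    rw [abs_mul, abs_of_pos (ha.trans_le (h.bd y).1)]
    exact mul_le_mul (hB x) (h.bd y).2 (ha.le.trans (h.bd y).1) ((abs_nonneg _).trans (hB 0))
  have := e y x
  rw [mul_comm] at this
  refine (abs_add_le _ _).trans ?_
  linarith [e x y]

lemma St_nice {a b : ℝ} {f f' : ℝ → ℝ} (h : Nice a b f f') (ha : 0 < a) :
    Nice (a ^ 2) (b ^ 2) (St f) (fun u => rr * ∫ v, (f' (rr * u - rr * v) * f (rr * u + rr * v)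
      + f (rr * u - rr * v) * f' (rr * u + rr * v)) ∂gam) := by
  obtain ⟨B, hB⟩ := h.hB
  have hB0 : 0 ≤ B := (abs_nonneg _).trans (hB 0)
  have hfm := h.cont.measurable
  have hfc := h.cont
  have hc := h.hc
  have hp := h.prod_bd ha hB
  refine ⟨fun x => ?_, ?_, ⟨rr * (2 * (B * b)), fun x => ?_⟩, fun x => St_bd hfm ha h.bd x⟩
  · have := (hasDerivAt_integral_of_dominated_loc_of_deriv_le (μ := gam) (s := univ) (x₀ := x)
      (F := fun u v => f (rr * u - rr * v) * f (rr * u + rr * v))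
      (F' := fun u v => rr * (f' (rr * u - rr * v) * f (rr * u + rr * v)
      + f (rr * u - rr * v) * f' (rr * u + rr * v))) (bound := fun _ => rr * (2 * (B * b)))
      univ_mem (.of_forall fun x => (by fun_prop)) 
      (bd2_int (a := a ^ 2) (b := b ^ 2) (by fun_prop) (fun v => ?_)) (by fun_prop)
      (ae_of_all _ fun y x _ => ?_) (integrable_const _) (ae_of_all _ fun y x _ => ?_)).2
    · simp only [integral_const_mul] at this
      exact this
    · obtain ⟨h1, h2⟩ := h.bd (rr * x - rr * v)
      obtain ⟨h3, h4⟩ := h.bd (rr * x + rr * v)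
      constructor <;> nlinarith
    · rw [norm_mul, norm_eq_abs, norm_eq_abs, abs_of_pos rr_pos]
      exact mul_le_mul_of_nonneg_left (hp _ _) rr_pos.le
    · have h1 : HasDerivAt (fun x => rr * x - rr * y) rr x := by
        simpa using ((hasDerivAt_id x).const_mul rr).sub_const (rr * y)
      have h2 : HasDerivAt (fun x => rr * x + rr * y) rr x := by
        simpa using ((hasDerivAt_id x).const_mul rr).add_const (rr * y)
      have := ((h.hd _).comp x h1).mul ((h.hd _).comp x h2)
      refine this.congr_deriv ?_
      simp only [Function.comp]; ring
  · refine continuous_const.mul ?_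
    refine continuous_of_dominated (bound := fun _ => 2 * (B * b)) (fun x => by fun_prop)
      (fun x => ae_of_all _ fun y => hp _ _) (integrable_const _) (ae_of_all _ fun y => by fun_prop)
  · have := int_bds (μ := gam) (h := fun v => f' (rr * x - rr * v) * f (rr * x + rr * v)
      + f (rr * x - rr * v) * f' (rr * x + rr * v)) (by fun_prop)
      (fun v => abs_le.1 (hp _ _))
    rw [abs_mul, abs_of_pos rr_pos]
    exact mul_le_mul_of_nonneg_left (abs_le.2 this) rr_pos.le

lemma fubini {h : ℝ × ℝ → ℝ} (hi : Integrable h gam2) :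
    ∫ x, ∫ y, h (x, y) ∂gam ∂gam = ∫ p, h p ∂gam2 := (integral_prod _ hi).symm

/-- commutation of convolution and flow -/
lemma Pt_St {f : ℝ → ℝ} (hf : Measurable f) {B : ℝ} (hb : ∀ x, |f x| ≤ B) (θ : ℝ) :
    Pt θ (St f) = St (Pt θ f) := by
  ext u
  have hB0 : 0 ≤ B := (abs_nonneg _).trans (hb 0)
  have bb : ∀ x y, |f x * f y| ≤ B * B := fun x y => by
    rw [abs_mul]; exact mul_le_mul (hb x) (hb y) (abs_nonneg _) hB0
  have m2 : ∀ (e1 e2 : ℝ × ℝ → ℝ), Measurable e1 → Measurable e2 →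
      Measurable fun p => f (e1 p) * f (e2 p) := fun e1 e2 h1 h2 => (hf.comp h1).mul (hf.comp h2)
  -- left side
  have hL : Pt θ (St f) u = ∫ w, ∫ v, f (rr * (cos θ * u + sin θ * w) - rr * v)
      * f (rr * (cos θ * u + sin θ * w) + rr * v) ∂gam ∂gam := rfl
  -- right side
  have hR : St (Pt θ f) u = ∫ v, ∫ w, ∫ z, f (rr * (cos θ * u + sin θ * w)
      - rr * (cos θ * v + sin θ * z)) * f (rr * (cos θ * u + sin θ * w)
      + rr * (cos θ * v + sin θ * z)) ∂gam ∂gam ∂gam := by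
    unfold St
    congr 1; ext v
    unfold Pt
    rw [← integral_prod_mul, ← integral_rot (-(π / 4))]
    rw [← fubini]
    · congr 1; ext w; congr 1; ext z
      simp only [rot_r]
      congr 2 <;> ring
    · refine (integrable_rot (h := fun p => f (cos θ * (rr * u - rr * v) + sin θ * p.1) *
        f (cos θ * (rr * u + rr * v) + sin θ * p.2))).2 ?_
      exact bd_int (m2 _ _ (by fun_prop) (by fun_prop)).aestronglyMeasurable (B * B)
        (fun p => bb _ _)
  rw [hL, hR]
  -- swap v and w
  symm
  rw [integral_integral_swap]
  · symm; congr 1; ext w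
    set t := cos θ * u + sin θ * w
    have i2 : Integrable (fun p : ℝ × ℝ => f (rr * t - rr * p.1) * f (rr * t + rr * p.1)) gam2 :=
      bd_int (m2 _ _ (by fun_prop) (by fun_prop)).aestronglyMeasurable (B * B) (fun p => bb _ _)
    have e1 := fubini (h := fun p => f (rr * t - rr * (rot θ p).1) * f (rr * t + rr * (rot θ p).1))
      ((integrable_rot
        (h := fun p : ℝ × ℝ => f (rr * t - rr * p.1) * f (rr * t + rr * p.1))).2 i2)
    have e2 := integral_rot θ (fun p => f (rr * t - rr * p.1) * f (rr * t + rr * p.1))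
    have e3 := fubini i2
    simp only [integral_const, probReal_univ, one_smul] at e3
    rw [e3, ← e2, ← e1]
    rfl
  · have hm : Measurable (fun q : (ℝ × ℝ) × ℝ => f (rr * (cos θ * u + sin θ * q.1.2)
      - rr * (cos θ * q.1.1 + sin θ * q.2)) * f (rr * (cos θ * u + sin θ * q.1.2)
      + rr * (cos θ * q.1.1 + sin θ * q.2))) :=
      (hf.comp (by fun_prop)).mul (hf.comp (by fun_prop))
    have := hm.stronglyMeasurable.integral_prod_right' (ν := gam)
    refine bd_int (C := B * B) this.aestronglyMeasurable fun p => ?_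
    exact abs_le.2 (int_bds (μ := gam) (hm.comp (by fun_prop : Measurable fun z : ℝ => (p, z))).aestronglyMeasurable
      (fun v => abs_le.1 (bb _ _)))

/-- entropy of a density with respect to the Gaussian -/
def En (f : ℝ → ℝ) : ℝ := ∫ x, f x * log (f x) ∂gam

/-- relative Fisher information of a density with respect to the Gaussian -/
def Ji (f : ℝ → ℝ) : ℝ := ∫ x, (deriv f x) ^ 2 / f x ∂gam

/-- bound for the derivative of `t log t` on `[a,b]` -/
def KK (a b : ℝ) : ℝ := max |log a| |log b| + 1

lemma log_bd {a b t : ℝ} (ha : 0 < a) (h : a ≤ t ∧ t ≤ b) : |log t + 1| ≤ KK a b := by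
  have := abs_le_max_abs_abs (log_le_log ha h.1) (log_le_log (ha.trans_le h.1) h.2)
  refine (abs_add_le _ _).trans ?_
  simp [KK, this]

lemma KK_nonneg (a b : ℝ) : 0 ≤ KK a b := by unfold KK; positivity

lemma phi_lip {a b s t : ℝ} (ha : 0 < a) (hs : a ≤ s ∧ s ≤ b) (ht : a ≤ t ∧ t ≤ b) :
    |s * log s - t * log t| ≤ KK a b * |s - t| := by
  have := (convex_Icc a b).norm_image_sub_le_of_norm_hasDerivWithin_le (C := KK a b)
    (f := fun x => x * log x) (f' := fun x => log x + 1) (x := t) (y := s)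
    (fun x hx => (hasDerivAt_mul_log (ha.trans_le hx.1).ne').hasDerivWithinAt)
    (fun x hx => log_bd ha hx) ht hs
  exact this

lemma phi_int {α : Type*} [MeasurableSpace α] {μ : Measure α} [IsProbabilityMeasure μ]
    {f : α → ℝ} (hf : Measurable f) {a b : ℝ} (ha : 0 < a)
    (hb : ∀ x, a ≤ f x ∧ f x ≤ b) : Integrable (fun x => f x * log (f x)) μ := by
  refine bd_int (hf.mul (measurable_log.comp hf)).aestronglyMeasurable
    (KK a b * |b - a| + |a * log a|) fun x => ?_
  have h1 := phi_lip ha (hb x) ⟨le_rfl, (hb x).1.trans (hb x).2⟩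
  have h2 : |f x - a| ≤ |b - a| := by
    rw [abs_of_nonneg (by linarith [hb x]), abs_of_nonneg (by linarith [hb x])]
    linarith [hb x]
  have h3 := mul_le_mul_of_nonneg_left h2 (KK_nonneg a b)
  have h4 := abs_sub_abs_le_abs_sub (f x * log (f x)) (a * log a)
  linarith

lemma En_jensen {f : ℝ → ℝ} (hf : Measurable f) {a b : ℝ} (ha : 0 < a)
    (hb : ∀ x, a ≤ f x ∧ f x ≤ b) (θ : ℝ) : En (Pt θ f) ≤ En f := by
  have m1 : Measurable fun p : ℝ × ℝ => f (cos θ * p.1 + sin θ * p.2) := hf.comp (by fun_prop)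
  have i2 : Integrable (fun p : ℝ × ℝ => f (cos θ * p.1 + sin θ * p.2) *
      log (f (cos θ * p.1 + sin θ * p.2))) gam2 := phi_int m1 ha (fun _ => hb _)
  have h1 : ∀ x, Pt θ f x * log (Pt θ f x) ≤ ∫ y, f (cos θ * x + sin θ * y) *
      log (f (cos θ * x + sin θ * y)) ∂gam := by
    intro x
    have m3 : Measurable fun y : ℝ => f (cos θ * x + sin θ * y) := hf.comp (by fun_prop)
    exact convexOn_mul_log.map_integral_le continuous_mul_log.continuousOn isClosed_Ici
      (ae_of_all _ fun y => (ha.le.trans (hb _).1 : (0:ℝ) ≤ _))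
      (bd2_int m3.aestronglyMeasurable (fun _ => hb _)) (phi_int m3 ha (fun _ => hb _))
  have h2 := integral_mono (phi_int (Pt_meas hf θ) ha (Pt_bd hf hb θ)) i2.integral_prod_left h1
  refine h2.trans (le_of_eq ?_)
  rw [fubini i2]
  have e2 := integral_rot θ (fun p => f p.1 * log (f p.1))
  have i3 : Integrable (fun p : ℝ × ℝ => f p.1 * log (f p.1)) gam2 :=
    phi_int (hf.comp measurable_fst) ha (fun _ => hb _)
  rw [← fubini i3] at e2
  simp only [integral_const, probReal_univ, one_smul] at e2
  exact e2

lemma En_nonneg {f : ℝ → ℝ} (hf : Measurable f) {a b : ℝ} (ha : 0 < a)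
    (hb : ∀ x, a ≤ f x ∧ f x ≤ b) (h1 : ∫ x, f x ∂gam = 1) : 0 ≤ En f := by
  have hi := bd2_int (μ := gam) hf.aestronglyMeasurable hb
  have : ∫ x, (f x - 1) ∂gam ≤ En f := by
    refine integral_mono (hi.sub (integrable_const 1)) (phi_int hf ha hb) fun x => ?_
    have hp := ha.trans_le (hb x).1
    have := one_sub_inv_le_log_of_pos hp
    have := mul_le_mul_of_nonneg_left this hp.le
    rw [mul_sub, mul_inv_cancel₀ hp.ne'] at this
    simpa using this
  rw [integral_sub hi (integrable_const 1), h1] at this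
  simpa using this

lemma En_tendsto {f : ℝ → ℝ} (hf : Measurable f) {a b : ℝ} (ha : 0 < a)
    (hb : ∀ x, a ≤ f x ∧ f x ≤ b) : Tendsto (fun θ => En (Pt θ f)) (𝓝 0) (𝓝 (En f)) := by
  have mm : ∀ θ, Measurable fun p => f (rot θ p).1 := fun θ =>
    hf.comp (measurable_fst.comp (rot_cont θ).measurable)
  have ii : ∀ θ, Integrable (fun p => f (rot θ p).1) gam2 := fun θ =>
    bd2_int (mm θ).aestronglyMeasurable (fun _ => hb _)
  have ii0 : Integrable (fun p : ℝ × ℝ => f p.1) gam2 :=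
    bd2_int (hf.comp measurable_fst).aestronglyMeasurable (fun _ => hb _)
  have L1 : Tendsto (fun θ => ∫ p, |f (rot θ p).1 - f p.1| ∂gam2) (𝓝 0) (𝓝 0) := by
    let G : C(ℝ × (ℝ × ℝ), ℝ × ℝ) := ⟨fun q => rot q.1 q.2, by unfold rot; fun_prop⟩
    have hG : ∀ θ, MeasurePreserving (G.curry θ) gam2 gam2 := fun θ => rot_mp θ
    let F : Lp ℝ 1 gam2 := (memLp_one_iff_integrable.2 ii0).toLp
    have t := Filter.Tendsto.compMeasurePreservingLp (l := 𝓝 0) (f := fun _ : ℝ => F) (f₀ := F)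
      tendsto_const_nhds (G.curry.continuous.tendsto 0) hG (hG 0) (by simp)
    have t2 := tendsto_iff_dist_tendsto_zero.1 t
    refine t2.congr fun θ => ?_
    rw [dist_eq_norm, L1.norm_eq_integral_norm]
    refine integral_congr_ae ?_
    have e0 := (Lp.coeFn_compMeasurePreserving F (hG 0))
    have e1 := (Lp.coeFn_compMeasurePreserving F (hG θ))
    have e2 : F =ᵐ[gam2] fun p => f p.1 := MemLp.coeFn_toLp _
    filter_upwards [Lp.coeFn_sub (Lp.compMeasurePreserving (G.curry θ) (hG θ) F)
      (Lp.compMeasurePreserving (G.curry 0) (hG 0) F), e0, e1,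
      (hG θ).quasiMeasurePreserving.ae_eq_comp e2, (hG 0).quasiMeasurePreserving.ae_eq_comp e2]
      with p h1 h2 h3 h4 h5
    rw [h1, Pi.sub_apply, h2, h3, h4, h5, norm_eq_abs]
    simp [G, rot_zero]
  rw [tendsto_iff_norm_sub_tendsto_zero]
  refine squeeze_zero (fun _ => norm_nonneg _) (fun θ => ?_)
    (by simpa using L1.const_mul (KK a b))
  have i1 := phi_int (μ := gam) (Pt_meas hf θ) ha (Pt_bd hf hb θ)
  have i2 := phi_int (μ := gam) hf ha hb
  have i4 : Integrable (fun p => |f (rot θ p).1 - f p.1|) gam2 := ((ii θ).sub ii0).abs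
  unfold En
  rw [← integral_sub i1 i2, ← fubini i4, ← integral_const_mul]
  refine norm_integral_le_of_norm_le (i4.integral_prod_left.const_mul _) (ae_of_all _ fun x => ?_)
  refine (phi_lip ha (Pt_bd hf hb θ x) (hb x)).trans ?_
  refine mul_le_mul_of_nonneg_left ?_ (KK_nonneg a b)
  have m3 : Measurable fun y : ℝ => f (cos θ * x + sin θ * y) := hf.comp (by fun_prop)
  have i5 : Integrable (fun y : ℝ => f (cos θ * x + sin θ * y)) gam :=
    bd2_int m3.aestronglyMeasurable (fun _ => hb _)
  have : Pt θ f x - f x = ∫ y, (f (cos θ * x + sin θ * y) - f x) ∂gam := by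
    rw [integral_sub i5 (integrable_const _)]; simp [Pt]
  rw [this]
  exact abs_integral_le_integral_abs

lemma Pt_moments {f : ℝ → ℝ} (hf : Measurable f) {B : ℝ} (hb : ∀ x, |f x| ≤ B)
    (h0 : ∫ x, f x ∂gam = 1) (h1 : ∫ x, x * f x ∂gam = 0) (h2 : ∫ x, x ^ 2 * f x ∂gam = 1) (θ : ℝ) :
    ∫ x, Pt θ f x ∂gam = 1 ∧ ∫ x, x * Pt θ f x ∂gam = 0 ∧ ∫ x, x ^ 2 * Pt θ f x ∂gam = 1 := by
  have hB0 : 0 ≤ B := (abs_nonneg _).trans (hb 0)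
  have I0 : Integrable f gam := bd_int hf.aestronglyMeasurable B hb
  have I1 : Integrable (fun x => x * f x) gam := by
    simpa [mul_comm] using (pow_int 1).bdd_mul hf.aestronglyMeasurable (ae_of_all _ hb)
  have I2 : Integrable (fun x => x ^ 2 * f x) gam := by
    simpa [mul_comm] using (pow_int 2).bdd_mul hf.aestronglyMeasurable (ae_of_all _ hb)
  have gen : ∀ k : ℝ → ℝ, Integrable (fun p : ℝ × ℝ => k (rot (-θ) p).1 * f p.1) gam2 →
      ∫ x, k x * Pt θ f x ∂gam = ∫ p : ℝ × ℝ, k (rot (-θ) p).1 * f p.1 ∂gam2 := by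
    intro k hk
    have hk2 := (integrable_rot (θ := θ)).2 hk
    have e := integral_rot θ (fun p => k (rot (-θ) p).1 * f p.1)
    rw [← e, ← fubini hk2]
    simp only [rot_neg_rot, integral_const_mul]
    rfl
  have c1 := Real.sin_sq_add_cos_sq θ
  refine ⟨?_, ?_, ?_⟩
  · have := gen (fun _ => 1) (by simpa using I0.mul_prod (integrable_const (1:ℝ)))
    simp only [one_mul] at this
    rw [this]
    simpa [h0] using integral_prod_mul (μ := gam) (ν := gam) f (fun _ => (1:ℝ))
  · have iA := (I1.mul_prod (integrable_const (1:ℝ) (μ := gam))).const_mul (cos θ)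
    have iB := (I0.mul_prod (pow_int 1)).const_mul (sin θ)
    have ee : ∀ p : ℝ × ℝ, (rot (-θ) p).1 * f p.1 =
        cos θ * ((p.1 * f p.1) * 1) - sin θ * (f p.1 * p.2 ^ 1) := by
      intro p; simp [rot]; ring
    rw [gen (fun x => x) (by simp only [ee]; exact iA.sub iB)]
    simp only [ee]
    rw [integral_sub iA iB, integral_const_mul, integral_const_mul,
      integral_prod_mul (fun x => x * f x) (fun _ => (1 : ℝ)), integral_prod_mul f (fun y => y ^ 1)]
    simp [h1]
  · have iA := (I2.mul_prod (integrable_const (1:ℝ) (μ := gam))).const_mul (cos θ ^ 2)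
    have iB := (I1.mul_prod (pow_int 1)).const_mul (2 * sin θ * cos θ)
    have iC := (I0.mul_prod (pow_int 2)).const_mul (sin θ ^ 2)
    have ee : ∀ p : ℝ × ℝ, (rot (-θ) p).1 ^ 2 * f p.1 =
        cos θ ^ 2 * ((p.1 ^ 2 * f p.1) * 1) - 2 * sin θ * cos θ * ((p.1 * f p.1) * p.2 ^ 1)
        + sin θ ^ 2 * (f p.1 * p.2 ^ 2) := by
      intro p; simp [rot]; ring
    rw [gen (fun x => x ^ 2) (by simp only [ee]; exact (iA.sub iB).add iC)]
    simp only [ee]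
    have iAB : Integrable (fun p : ℝ × ℝ => cos θ ^ 2 * ((p.1 ^ 2 * f p.1) * 1)
        - 2 * sin θ * cos θ * ((p.1 * f p.1) * p.2 ^ 1)) gam2 := iA.sub iB
    rw [integral_add iAB iC, integral_sub iA iB, integral_const_mul, integral_const_mul,
      integral_const_mul, integral_prod_mul (fun x => x ^ 2 * f x) (fun _ => (1 : ℝ)),
      integral_prod_mul f (fun y => y ^ 2),
      integral_prod_mul (fun x => x * f x) (fun y => y ^ 1)]
    simp only [h0, h1, h2, int_x2]
    simp

/-- the derivative of the flow in the angle -/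
def Dt (θ : ℝ) (f' : ℝ → ℝ) (x : ℝ) : ℝ :=
  ∫ y, f' (cos θ * x + sin θ * y) * (-sin θ * x + cos θ * y) ∂gam

lemma abs_rot2 (θ x y : ℝ) : |-sin θ * x + cos θ * y| ≤ |x| + |y| := by
  refine (abs_add_le _ _).trans ?_
  rw [abs_mul, abs_mul, abs_neg]
  have h1 := mul_le_mul_of_nonneg_right (abs_sin_le_one θ) (abs_nonneg x)
  have h2 := mul_le_mul_of_nonneg_right (abs_cos_le_one θ) (abs_nonneg y)
  linarith

lemma abs_int : Integrable (fun x : ℝ => |x|) gam := by simpa using (pow_int 1).abs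

lemma Dt_integrand_bd {f' : ℝ → ℝ} {B : ℝ} (hB : ∀ x, |f' x| ≤ B) (θ x y : ℝ) :
    |f' (cos θ * x + sin θ * y) * (-sin θ * x + cos θ * y)| ≤ B * (|x| + |y|) := by
  rw [abs_mul]
  exact mul_le_mul (hB _) (abs_rot2 _ _ _) (abs_nonneg _) ((abs_nonneg _).trans (hB 0))

lemma Dt_bd {f' : ℝ → ℝ} {B : ℝ} (hB : ∀ x, |f' x| ≤ B) (θ x : ℝ) :
    |Dt θ f' x| ≤ B * (|x| + ∫ y, |y| ∂gam) := by
  have hi : Integrable (fun y : ℝ => B * (|x| + |y|)) gam :=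
    ((integrable_const _).add abs_int).const_mul B
  have := norm_integral_le_of_norm_le
    (f := fun y => f' (cos θ * x + sin θ * y) * (-sin θ * x + cos θ * y)) hi (ae_of_all _ fun y => Dt_integrand_bd hB θ x y)
  rw [integral_const_mul, integral_add (integrable_const _) abs_int] at this
  simpa [Dt] using this

lemma Dt_meas {f' : ℝ → ℝ} (hc : Continuous f') (θ : ℝ) : Measurable (Dt θ f') := by
  have : StronglyMeasurable (fun p : ℝ × ℝ =>
      f' (cos θ * p.1 + sin θ * p.2) * (-sin θ * p.1 + cos θ * p.2)) :=
    Continuous.stronglyMeasurable (by fun_prop)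
  exact (this.integral_prod_right' (ν := gam)).measurable

lemma Pt_hasDerivAt_angle {a b : ℝ} {f f' : ℝ → ℝ} (h : Nice a b f f') (θ x : ℝ) :
    HasDerivAt (fun θ => Pt θ f x) (Dt θ f' x) θ := by
  obtain ⟨B, hB⟩ := h.hB
  have hfc := h.cont
  have hc := h.hc
  refine (hasDerivAt_integral_of_dominated_loc_of_deriv_le (μ := gam) (s := univ) (x₀ := θ)
      (F := fun θ y => f (cos θ * x + sin θ * y))
      (F' := fun θ y => f' (cos θ * x + sin θ * y) * (-sin θ * x + cos θ * y))
      (bound := fun y => B * (|x| + |y|))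
      univ_mem (.of_forall fun x => (by fun_prop)) 
      (bd2_int (by fun_prop) (fun y => h.bd _)) (by fun_prop)
      (ae_of_all _ fun y θ _ => Dt_integrand_bd hB _ _ _)
      (((integrable_const _).add abs_int).const_mul B) (ae_of_all _ fun y θ _ => ?_)).2
  exact (h.hd _).comp θ (((hasDerivAt_cos θ).mul_const x).add ((hasDerivAt_sin θ).mul_const y))

lemma En_hasDerivAt {a b : ℝ} {f f' : ℝ → ℝ} (h : Nice a b f f') (ha : 0 < a) (θ : ℝ) :
    HasDerivAt (fun θ => En (Pt θ f)) (∫ x, (log (Pt θ f x) + 1) * Dt θ f' x ∂gam) θ := by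
  obtain ⟨B, hB⟩ := h.hB
  have hm := h.cont.measurable
  have hP := Pt_bd hm h.bd
  refine (hasDerivAt_integral_of_dominated_loc_of_deriv_le (μ := gam) (s := univ) (x₀ := θ)
      (F := fun θ x => Pt θ f x * log (Pt θ f x))
      (F' := fun θ x => (log (Pt θ f x) + 1) * Dt θ f' x)
      (bound := fun x => KK a b * (B * (|x| + ∫ y, |y| ∂gam)))
      univ_mem (.of_forall fun θ => (phi_int (Pt_meas hm θ) ha (hP θ)).1) 
      (phi_int (Pt_meas hm θ) ha (hP θ))
      (((measurable_log.comp (Pt_meas hm θ)).add_const 1).mul (Dt_meas h.hc θ)).aestronglyMeasurable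
      (ae_of_all _ fun x θ _ => ?_)
      (((abs_int.add (integrable_const _)).const_mul B).const_mul _)
      (ae_of_all _ fun x θ _ => ?_)).2
  · rw [norm_mul]
    exact mul_le_mul (log_bd ha (hP θ x)) (Dt_bd hB θ x) (abs_nonneg _) (KK_nonneg _ _)
  · exact (hasDerivAt_mul_log (ha.trans_le (hP θ x).1).ne').comp θ (Pt_hasDerivAt_angle h θ x)

lemma En_deriv_eq {a b : ℝ} {f f' : ℝ → ℝ} (h : Nice a b f f') (ha : 0 < a) (θ : ℝ) :
    cos θ * (∫ x, (log (Pt θ f x) + 1) * Dt θ f' x ∂gam) = -sin θ * Ji (Pt θ f) := by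
  obtain ⟨B, hB⟩ := h.hB
  have hm := h.cont.measurable
  have hN := Pt_nice h θ
  have hc := h.hc
  obtain ⟨B', hB'⟩ := hN.hB
  have hFc := hN.cont
  have hFc' := hN.hc
  have hpos : ∀ x, 0 < Pt θ f x := fun x => ha.trans_le (hN.bd x).1
  have hpos' : ∀ x, Pt θ f x ≠ 0 := fun x => (hpos x).ne'
  set F := Pt θ f with hF
  set F' := fun x => cos θ * Pt θ f' x with hF'
  have logc : Continuous fun x => log (F x) := hFc.log hpos'
  have dc : Continuous fun x => F' x / F x := hFc'.div hFc hpos'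
  have K1 : ∀ x, |log (F x) + 1| ≤ KK a b := fun x => log_bd ha (hN.bd x)
  have K2 : ∀ x, |F' x / F x| ≤ B' / a := fun x => by
    rw [abs_div, abs_of_pos (hpos x)]
    exact div_le_div₀ ((abs_nonneg _).trans (hB' 0)) (hB' x) ha (hN.bd x).1
  -- 2D function
  let h2 : ℝ × ℝ → ℝ := fun p => (log (F (rot (-θ) p).1) + 1) * (f' p.1 * p.2)
  have h2c : Continuous h2 := by
    have := rot_cont (-θ)
    have : Continuous fun p => log (F (rot (-θ) p).1) := logc.comp (by fun_prop)
    fun_prop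
  have i2 : Integrable h2 gam2 := by
    have : Integrable (fun p : ℝ × ℝ => f' p.1 * p.2 ^ 1) gam2 :=
      (bd_int hc.aestronglyMeasurable B hB).mul_prod (pow_int 1)
    simp only [pow_one] at this
    refine this.bdd_mul (c := KK a b) ?_ (ae_of_all _ fun p => K1 _)
    have := rot_cont (-θ)
    have : Continuous fun p => log (F (rot (-θ) p).1) := logc.comp (by fun_prop)
    exact (this.add_const 1).aestronglyMeasurable
  have s1 : ∫ x, (log (F x) + 1) * Dt θ f' x ∂gam = ∫ p, h2 p ∂gam2 := by
    rw [← integral_rot θ h2, ← fubini ((integrable_rot (θ := θ)).2 i2)]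
    simp only [h2, rot_neg_rot, integral_const_mul]
    rfl
  let h3 : ℝ × ℝ → ℝ := fun p => (F' (rot (-θ) p).1 / F (rot (-θ) p).1) * f' p.1
  have h3c : Continuous h3 := by
    have := rot_cont (-θ)
    have : Continuous fun p => F' (rot (-θ) p).1 / F (rot (-θ) p).1 :=
      dc.comp (g := fun x => F' x / F x) (f := fun p => (rot (-θ) p).1) (by fun_prop)
    fun_prop
  have i3 : Integrable h3 gam2 := by
    refine bd_int h3c.aestronglyMeasurable ((B' / a) * B) fun p => ?_
    rw [abs_mul]
    exact mul_le_mul (K2 _) (hB _) (abs_nonneg _) ((abs_nonneg _).trans (K2 0))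
  have s2 : ∫ p, h2 p ∂gam2 = -sin θ * ∫ p, h3 p ∂gam2 := by
    rw [← fubini i2, ← fubini i3, ← integral_const_mul]
    congr 1; ext X
    have hd : ∀ Y, HasDerivAt (fun Y => log (F (rot (-θ) (X, Y)).1) + 1)
        (-sin θ * (F' (rot (-θ) (X, Y)).1 / F (rot (-θ) (X, Y)).1)) Y := by
      intro Y
      have e1 : HasDerivAt (fun Y => (rot (-θ) (X, Y)).1) (-sin θ) Y := by
        simpa [rot] using (((hasDerivAt_id Y).const_mul (sin θ)).neg).const_add (cos θ * X)
      have e2 := (((hN.hd _).comp Y e1).log (hpos' _)).add_const 1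
      refine e2.congr_deriv ?_
      simp only [Function.comp]; ring
    have ch : Continuous (fun Y => log (F (rot (-θ) (X, Y)).1) + 1) :=
      continuous_iff_continuousAt.2 fun Y => (hd Y).continuousAt
    have ch' : Continuous (fun Y => (F' (rot (-θ) (X, Y)).1 / F (rot (-θ) (X, Y)).1)) := by
      have := rot_cont (-θ)
      exact dc.comp (g := fun x => F' x / F x) (f := fun p => (rot (-θ) (X, p)).1) (by fun_prop)
    have st := stein hd (bd_int ch.aestronglyMeasurable _ fun Y => K1 _)
      ((bd_int ch'.aestronglyMeasurable _ fun Y => K2 _).const_mul _) (by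
        have := (pow_int 1).bdd_mul ch.aestronglyMeasurable (ae_of_all _ fun Y => K1 _)
        refine this.congr (ae_of_all _ fun Y => ?_)
        simp only [pow_one]; ring)
    rw [integral_const_mul] at st
    calc ∫ Y, h2 (X, Y) ∂gam
        = f' X * ∫ Y, Y * (log (F (rot (-θ) (X, Y)).1) + 1) ∂gam := by
          rw [← integral_const_mul]; congr 1; ext Y; simp only [h2]; ring
      _ = -sin θ * (∫ Y, h3 (X, Y) ∂gam) := by
          rw [← st]; simp only [h3]; rw [integral_mul_const]; ring
  have s3 : cos θ * ∫ p, h3 p ∂gam2 = Ji F := by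
    rw [← integral_rot θ h3, ← fubini ((integrable_rot (θ := θ)).2 i3), ← integral_const_mul]
    unfold Ji
    rw [hN.deriv_eq]
    congr 1; ext x
    simp only [h3, rot_neg_rot, integral_const_mul]
    have : ∫ y, f' (rot θ (x, y)).1 ∂gam = Pt θ f' x := rfl
    rw [this, hF']
    ring
  rw [s1, s2, ← s3]; ring

lemma gauss_int : Integrable gaussPDF := by
  have := integrable_gam.1 (integrable_const (1 : ℝ) (μ := gam))
  simpa using this

lemma gauss_int1 : Integrable (fun x => -x * gaussPDF x) := by
  have := (integrable_gam.1 (pow_int 1)).neg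
  refine this.congr (ae_of_all _ fun x => ?_)
  simp; ring

lemma gauss_tail_Iic (x : ℝ) : ∫ t in Iic x, -t * gaussPDF t = gaussPDF x := by
  have A : Tendsto gaussPDF atBot (𝓝 0) :=
    tendsto_zero_of_hasDerivAt_of_integrableOn_Iic (a := 0) (fun x _ ↦ gaussPDF_deriv x)
      gauss_int1.integrableOn gauss_int.integrableOn
  simpa using integral_Iic_of_hasDerivAt_of_tendsto' (fun x _ ↦ gaussPDF_deriv x)
    gauss_int1.integrableOn A (a := x)

lemma gauss_tail_Ioi (x : ℝ) : ∫ t in Ioi x, t * gaussPDF t = gaussPDF x := by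
  have A : Tendsto gaussPDF atTop (𝓝 0) :=
    tendsto_zero_of_hasDerivAt_of_integrableOn_Ioi (a := 0) (fun x _ ↦ gaussPDF_deriv x)
      gauss_int1.integrableOn gauss_int.integrableOn
  have := integral_Ioi_of_hasDerivAt_of_tendsto' (fun x _ ↦ gaussPDF_deriv x)
    gauss_int1.integrableOn A (a := x)
  simp only [neg_mul, integral_neg] at this
  linarith

lemma exists_a {b : ℝ → ℝ} (hb : Continuous b) {B : ℝ} (hB : ∀ x, |b x| ≤ B)
    (h0 : ∫ x, b x ∂gam = 0) :
    ∃ A : ℝ → ℝ, (∀ x, HasDerivAt A (x * A x - b x) x) ∧ (∃ C, ∀ x, |A x| ≤ C) ∧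
      ∀ x, |x * A x| ≤ B := by
  have hB0 : 0 ≤ B := (abs_nonneg _).trans (hB 0)
  have hi : Integrable (fun t => gaussPDF t * b t) :=
    integrable_gam.1 (bd_int hb.aestronglyMeasurable B hB)
  have hc : Continuous (fun t => gaussPDF t * b t) := gaussPDF_cont.mul hb
  have hz : ∫ t, gaussPDF t * b t = 0 := by rw [← integral_gam, h0]
  let G : ℝ → ℝ := fun x => ∫ t in Iic x, gaussPDF t * b t
  have hG : ∀ x, HasDerivAt G (gaussPDF x * b x) x := by
    intro x
    have e : G = fun x => G 0 + ∫ t in (0:ℝ)..x, gaussPDF t * b t := by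
      ext x
      rw [← intervalIntegral.integral_Iic_sub_Iic hi.integrableOn hi.integrableOn]
      simp [G]
    rw [e]
    exact (intervalIntegral.integral_hasDerivAt_right hi.intervalIntegrable
      hc.stronglyMeasurable.stronglyMeasurableAtFilter hc.continuousAt).const_add _
  have hG2 : ∀ x, |x * G x| ≤ B * gaussPDF x := by
    intro x
    have bnd : ∀ t, |gaussPDF t * b t| ≤ B * gaussPDF t := fun t => by
      rw [abs_mul, abs_of_pos (gaussPDF_pos t), mul_comm]
      exact mul_le_mul_of_nonneg_right (hB t) (gaussPDF_pos t).le
    rcases le_total x 0 with hx | hx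
    · simp only [G]
      rw [← gauss_tail_Iic x, ← integral_const_mul, ← integral_const_mul, ← norm_eq_abs]
      refine norm_integral_le_of_norm_le (f := fun t => x * (gaussPDF t * b t))
        (g := fun t => B * (-t * gaussPDF t)) (μ := volume.restrict (Iic x))
        (gauss_int1.integrableOn.const_mul B) ?_
      refine (ae_restrict_iff' measurableSet_Iic).2 (ae_of_all _ fun t ht => ?_)
      simp only [mem_Iic] at ht
      rw [norm_mul, norm_eq_abs, norm_eq_abs, abs_of_nonpos hx]
      have := mul_le_mul (neg_le_neg ht) (bnd t) (abs_nonneg _) (by linarith)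
      linarith
    · have e : G x = -∫ t in Ioi x, gaussPDF t * b t := by
        have := integral_add_compl (measurableSet_Iic (a := x)) hi
        rw [compl_Iic, hz] at this
        simp only [G]; linarith
      rw [e, mul_neg, abs_neg, ← gauss_tail_Ioi x, ← integral_const_mul, ← integral_const_mul,
        ← norm_eq_abs]
      have gi : Integrable (fun t => t * gaussPDF t) := by
        simpa using gauss_int1.neg
      refine norm_integral_le_of_norm_le (f := fun t => x * (gaussPDF t * b t))
        (g := fun t => B * (t * gaussPDF t)) (μ := volume.restrict (Ioi x))
        (gi.integrableOn.const_mul B) ?_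
      refine (ae_restrict_iff' measurableSet_Ioi).2 (ae_of_all _ fun t ht => ?_)
      simp only [mem_Ioi] at ht
      rw [norm_mul, norm_eq_abs, norm_eq_abs, abs_of_nonneg hx]
      have := mul_le_mul ht.le (bnd t) (abs_nonneg _) (by linarith)
      linarith
  have hA : ∀ x, HasDerivAt (fun x => -((gaussPDF x)⁻¹ * G x))
      (x * (-((gaussPDF x)⁻¹ * G x)) - b x) x := by
    intro x
    have hp := (gaussPDF_pos x).ne'
    refine (((gaussPDF_deriv x).inv hp).mul (hG x)).neg.congr_deriv ?_
    simp only [Pi.inv_apply]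
    field_simp
    ring
  have hA2 : ∀ x, |x * (-((gaussPDF x)⁻¹ * G x))| ≤ B := by
    intro x
    have hp := gaussPDF_pos x
    have : x * (-((gaussPDF x)⁻¹ * G x)) = -((x * G x) / gaussPDF x) := by field_simp
    rw [this, abs_neg, abs_div, abs_of_pos hp, div_le_iff₀ hp]
    exact hG2 x
  refine ⟨_, hA, ?_, hA2⟩
  have cA : Continuous (fun x => -((gaussPDF x)⁻¹ * G x)) :=
    continuous_iff_continuousAt.2 fun x => (hA x).continuousAt
  obtain ⟨C, hC⟩ := (isCompact_Icc (a := (-1:ℝ)) (b := 1)).exists_bound_of_continuousOn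
    cA.continuousOn
  refine ⟨max C B, fun x => ?_⟩
  by_cases hx : |x| ≤ 1
  · exact (hC x (abs_le.1 hx)).trans (le_max_left _ _)
  · have := hA2 x
    rw [abs_mul] at this
    push Not at hx
    refine le_trans ?_ (this.trans (le_max_right _ _))
    exact le_mul_of_one_le_left (abs_nonneg _) hx.le

lemma a_facts {A b : ℝ → ℝ} (hb : Continuous b) {B C : ℝ} (hB : ∀ x, |b x| ≤ B)
    (hA : ∀ x, HasDerivAt A (x * A x - b x) x) (hC : ∀ x, |A x| ≤ C)
    (hx : ∀ x, |x * A x| ≤ B) :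
    ∫ x, A x ∂gam = ∫ x, x * b x ∂gam ∧ ∫ x, A x ^ 2 ∂gam ≤ ∫ x, b x ^ 2 ∂gam := by
  have cA : Continuous A := continuous_iff_continuousAt.2 fun x => (hA x).continuousAt
  have hB0 : 0 ≤ B := (abs_nonneg _).trans (hB 0)
  have hC0 : 0 ≤ C := (abs_nonneg _).trans (hC 0)
  have iA : Integrable A gam := bd_int cA.aestronglyMeasurable C hC
  have ixA : Integrable (fun x => x * A x) gam := bd_int (by fun_prop) B hx
  have ib : Integrable b gam := bd_int hb.aestronglyMeasurable B hB
  have ixb : Integrable (fun x => x * b x) gam := by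
    simpa [mul_comm] using (pow_int 1).bdd_mul hb.aestronglyMeasurable (ae_of_all _ hB)
  have ixxA : Integrable (fun x => x * (x * A x)) gam := by
    have : AEStronglyMeasurable (fun x => x * A x) gam := by fun_prop
    simpa [mul_comm] using (pow_int 1).bdd_mul this (ae_of_all _ hx)
  constructor
  · have i1 : Integrable (fun x => A x + x * (x * A x - b x)) gam := by
      refine (iA.add (ixxA.sub ixb)).congr (ae_of_all _ fun x => ?_)
      simp; ring
    have st := stein (h := fun x => x * A x) (h' := fun x => A x + x * (x * A x - b x))
      (fun x => ((hasDerivAt_id x).mul (hA x)).congr_deriv (by simp)) ixA i1 ixxA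
    have e : ∫ x, (A x + x * (x * A x - b x)) ∂gam = ∫ x, A x ∂gam + (∫ x, x * (x * A x) ∂gam
        - ∫ x, x * b x ∂gam) := by
      have j : Integrable (fun x => x * (x * A x) - x * b x) gam := ixxA.sub ixb
      rw [← integral_sub ixxA ixb, ← integral_add iA j]
      congr 1; ext x; ring
    linarith
  · have iA2 : Integrable (fun x => A x ^ 2) gam := bd_int (by fun_prop) (C ^ 2) fun x => by
      rw [abs_pow]; exact pow_le_pow_left₀ (abs_nonneg _) (hC x) 2
    have ib2 : Integrable (fun x => b x ^ 2) gam := bd_int (by fun_prop) (B ^ 2) fun x => by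
      rw [abs_pow]; exact pow_le_pow_left₀ (abs_nonneg _) (hB x) 2
    have id2 : Integrable (fun x => (x * A x - b x) ^ 2) gam :=
      bd_int (by fun_prop) ((B + B) ^ 2) fun x => by
        rw [abs_pow]; refine pow_le_pow_left₀ (abs_nonneg _) ?_ 2
        exact (abs_sub _ _).trans (add_le_add (hx x) (hB x))
    have ixa2 : Integrable (fun x => x * A x ^ 2) gam :=
      bd_int (by fun_prop) (B * C) fun x => by
        rw [pow_two, ← mul_assoc, abs_mul]
        exact mul_le_mul (hx x) (hC x) (abs_nonneg _) hB0
    have ixa3 : Integrable (fun x => x * (x * A x ^ 2)) gam :=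
      bd_int (by fun_prop) (B * B) fun x => by
        rw [show x * (x * A x ^ 2) = (x * A x) * (x * A x) by ring, abs_mul]
        exact mul_le_mul (hx x) (hx x) (abs_nonneg _) hB0
    have e0 : ∀ x, A x ^ 2 + x * (2 * A x * (x * A x - b x)) =
        (x * (x * A x ^ 2)) + (A x ^ 2 + (x * A x - b x) ^ 2) - b x ^ 2 := fun x => by ring
    have i1 : Integrable (fun x => A x ^ 2 + x * (2 * A x * (x * A x - b x))) gam := by
      simp only [e0]
      exact (ixa3.add (iA2.add id2)).sub ib2
    have st := stein (h := fun x => x * A x ^ 2)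
      (h' := fun x => A x ^ 2 + x * (2 * A x * (x * A x - b x)))
      (fun x => ((hasDerivAt_id x).mul ((hA x).pow 2)).congr_deriv (by simp)) ixa2 i1 ixa3
    simp only [e0] at st
    have j1 : Integrable (fun x => A x ^ 2 + (x * A x - b x) ^ 2) gam := iA2.add id2
    have j2 : Integrable (fun x => (x * (x * A x ^ 2)) + (A x ^ 2 + (x * A x - b x) ^ 2)) gam :=
      ixa3.add j1
    rw [integral_sub j2 ib2, integral_add ixa3 j1, integral_add iA2 id2] at st
    have : 0 ≤ ∫ x, (x * A x - b x) ^ 2 ∂gam := integral_nonneg fun x => sq_nonneg _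
    linarith

/-- the test function for the Fisher information deficit -/
def qq (b A : ℝ → ℝ) (p : ℝ × ℝ) : ℝ := b p.1 + b p.2 - p.1 * A p.2 - p.2 * A p.1

lemma qq_facts {A b : ℝ → ℝ} (hb : Continuous b) {B C : ℝ} (hB : ∀ x, |b x| ≤ B)
    (hA : ∀ x, HasDerivAt A (x * A x - b x) x) (hC : ∀ x, |A x| ≤ C)
    (hx : ∀ x, |x * A x| ≤ B) (h0 : ∫ x, b x ∂gam = 0) (h1 : ∫ x, x * b x ∂gam = 0) :
    Integrable (qq b A) gam2 ∧ Integrable (fun p => qq b A p ^ 2) gam2 ∧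
    ∫ p, qq b A p ^ 2 ∂gam2 ≤ 16 * ∫ x, b x ^ 2 ∂gam ∧
    (∀ x, ∫ y, qq b A (x, y) ∂gam = b x) ∧
    (∀ u, ∫ v, qq b A (rr * u - rr * v, rr * u + rr * v) ∂gam = 0) := by
  obtain ⟨a1, a2⟩ := a_facts hb hB hA hC hx
  rw [h1] at a1
  have cA : Continuous A := continuous_iff_continuousAt.2 fun x => (hA x).continuousAt
  have cq : Continuous (qq b A) := by unfold qq; fun_prop
  have iA : Integrable A gam := bd_int cA.aestronglyMeasurable C hC
  have ib : Integrable b gam := bd_int hb.aestronglyMeasurable B hB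
  have ix : Integrable (fun x : ℝ => x) gam := by simpa using pow_int 1
  have ix2 := pow_int 2
  have iA2 : Integrable (fun x => A x ^ 2) gam := bd_int (by fun_prop) (C ^ 2) fun x => by
    rw [abs_pow]; exact pow_le_pow_left₀ (abs_nonneg _) (hC x) 2
  have ib2 : Integrable (fun x => b x ^ 2) gam := bd_int (by fun_prop) (B ^ 2) fun x => by
    rw [abs_pow]; exact pow_le_pow_left₀ (abs_nonneg _) (hB x) 2
  have ione : Integrable (fun _ : ℝ => (1:ℝ)) gam := integrable_const _
  have k1 : Integrable (fun p : ℝ × ℝ => b p.1 ^ 2 * 1) gam2 := ib2.mul_prod ione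
  have k2 : Integrable (fun p : ℝ × ℝ => 1 * b p.2 ^ 2) gam2 := ione.mul_prod ib2
  have k3 : Integrable (fun p : ℝ × ℝ => p.1 ^ 2 * A p.2 ^ 2) gam2 := ix2.mul_prod iA2
  have k4 : Integrable (fun p : ℝ × ℝ => A p.1 ^ 2 * p.2 ^ 2) gam2 := iA2.mul_prod ix2
  have k12 : Integrable (fun p : ℝ × ℝ => b p.1 ^ 2 * 1 + 1 * b p.2 ^ 2) gam2 := k1.add k2
  have k34 : Integrable (fun p : ℝ × ℝ => p.1 ^ 2 * A p.2 ^ 2 + A p.1 ^ 2 * p.2 ^ 2) gam2 :=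
    k3.add k4
  have k : Integrable (fun p : ℝ × ℝ => (b p.1 ^ 2 * 1 + 1 * b p.2 ^ 2) +
    (p.1 ^ 2 * A p.2 ^ 2 + A p.1 ^ 2 * p.2 ^ 2)) gam2 := k12.add k34
  have pw : ∀ p : ℝ × ℝ, qq b A p ^ 2 ≤ 4 * ((b p.1 ^ 2 * 1 + 1 * b p.2 ^ 2) +
    (p.1 ^ 2 * A p.2 ^ 2 + A p.1 ^ 2 * p.2 ^ 2)) := fun p => by
    unfold qq
    nlinarith [sq_nonneg (b p.1 - b p.2), sq_nonneg (b p.1 + p.1 * A p.2),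
      sq_nonneg (b p.1 + p.2 * A p.1), sq_nonneg (b p.2 + p.1 * A p.2),
      sq_nonneg (b p.2 + p.2 * A p.1), sq_nonneg (p.1 * A p.2 - p.2 * A p.1)]
  have iq2 : Integrable (fun p => qq b A p ^ 2) gam2 :=
    (k.const_mul 4).mono' (by fun_prop) (ae_of_all _ fun p => by
      rw [norm_eq_abs, abs_of_nonneg (sq_nonneg _)]; exact pw p)
  have iq : Integrable (qq b A) gam2 := by
    refine (iq2.add (integrable_const 1)).mono' cq.aestronglyMeasurable (ae_of_all _ fun p => ?_)
    simp only [norm_eq_abs, Pi.add_apply]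
    rw [abs_le]; constructor <;> nlinarith [sq_nonneg (qq b A p - 1), sq_nonneg (qq b A p + 1)]
  refine ⟨iq, iq2, ?_, fun x => ?_, fun u => ?_⟩
  · have := integral_mono iq2 (k.const_mul 4) pw
    rw [integral_const_mul, integral_add k12 k34, integral_add k1 k2, integral_add k3 k4] at this
    rw [integral_prod_mul (fun x => b x ^ 2) (fun _ => (1:ℝ)),
      integral_prod_mul (fun _ => (1:ℝ)) (fun x => b x ^ 2),
      integral_prod_mul (fun x => x ^ 2) (fun x => A x ^ 2),
      integral_prod_mul (fun x => A x ^ 2) (fun x => x ^ 2), int_x2] at this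
    simp only [integral_const, probReal_univ, one_smul, mul_one, one_mul] at this
    linarith
  · have e1 : Integrable (fun y => b x + b y) gam := (integrable_const _).add ib
    have e2 : Integrable (fun y => b x + b y - x * A y) gam := e1.sub (iA.const_mul x)
    simp only [qq]
    rw [integral_sub e2 (ix.mul_const _), integral_sub e1 (iA.const_mul x),
      integral_add (integrable_const _) ib, integral_const_mul, integral_mul_const, int_x, a1, h0]
    simp
  · have d1 : ∀ v, HasDerivAt (fun v => rr * u - rr * v) (-rr) v := fun v => by
      simpa using ((hasDerivAt_id v).const_mul rr).const_sub (rr * u)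
    have d2 : ∀ v, HasDerivAt (fun v => rr * u + rr * v) rr v := fun v => by
      simpa using ((hasDerivAt_id v).const_mul rr).const_add (rr * u)
    have bm : ∀ v, |A (rr * u + rr * v) - A (rr * u - rr * v)| ≤ C + C := fun v =>
      (abs_sub _ _).trans (add_le_add (hC _) (hC _))
    have bA : ∀ x, |x * A x - b x| ≤ B + B := fun x =>
      (abs_sub _ _).trans (add_le_add (hx _) (hB _))
    have cm : Continuous fun v => A (rr * u + rr * v) - A (rr * u - rr * v) := by fun_prop
    have i3 : Integrable (fun v => v * (A (rr * u + rr * v) - A (rr * u - rr * v))) gam := by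
      simpa [mul_comm] using ix.bdd_mul cm.aestronglyMeasurable (ae_of_all _ bm)
    have i2 : Integrable (fun v => ((rr * u + rr * v) * A (rr * u + rr * v) - b (rr * u + rr * v)) * rr
        - ((rr * u - rr * v) * A (rr * u - rr * v) - b (rr * u - rr * v)) * (-rr)) gam := by
      refine Integrable.sub ?_ ?_
      · exact Integrable.mul_const (bd_int (by fun_prop) (B + B) (fun v => bA (rr * u + rr * v))) _
      · exact Integrable.mul_const (bd_int (by fun_prop) (B + B) (fun v => bA (rr * u - rr * v))) _
    have st := stein (h := fun v => A (rr * u + rr * v) - A (rr * u - rr * v))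
      (h' := fun v => ((rr * u + rr * v) * A (rr * u + rr * v) - b (rr * u + rr * v)) * rr
        - ((rr * u - rr * v) * A (rr * u - rr * v) - b (rr * u - rr * v)) * (-rr))
      (fun v => ((hA _).comp v (d2 v)).sub ((hA _).comp v (d1 v)))
      (bd_int cm.aestronglyMeasurable _ bm) i2 i3
    have e : ∫ v, rr * qq b A (rr * u - rr * v, rr * u + rr * v) ∂gam = 0 := by
      rw [← sub_eq_zero.2 st.symm, ← integral_sub i3 i2]
      congr 1; ext v
      simp only [qq]
      have : v = 2 * rr ^ 2 * v := by rw [rr_sq]; ring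
      have h3 : v * (A (rr * u + rr * v) - A (rr * u - rr * v)) =
        2 * rr ^ 2 * v * (A (rr * u + rr * v) - A (rr * u - rr * v)) := by rw [← this]
      rw [h3]; ring
    rw [integral_const_mul] at e
    exact (mul_eq_zero.1 e).resolve_left rr_pos.ne'

lemma fisher_contract {a b : ℝ} {f f' : ℝ → ℝ} (h : Nice a b f f') (ha : 0 < a)
    (h0 : ∫ x, f x ∂gam = 1) (h1 : ∫ x, x * f x ∂gam = 0) (h2 : ∫ x, x ^ 2 * f x ∂gam = 1) :
    Ji (St f) ≤ (1 - a ^ 2 / (8 * b)) * Ji f := by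
  obtain ⟨B, hB⟩ := h.hB
  have hB0 : 0 ≤ B := (abs_nonneg _).trans (hB 0)
  have hfc := h.cont
  have hc := h.hc
  have fp : ∀ x, 0 < f x := fun x => ha.trans_le (h.bd x).1
  have bp : 0 < b := (fp 0).trans_le (h.bd 0).2
  have fb : ∀ x, |f x| ≤ b := fun x => by rw [abs_of_pos (fp x)]; exact (h.bd x).2
  have ix : Integrable (fun x : ℝ => x) gam := by simpa using pow_int 1
  have i_f : Integrable f gam := bd_int hfc.aestronglyMeasurable b fb
  have i_f' : Integrable f' gam := bd_int hc.aestronglyMeasurable B hB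
  have i_xf : Integrable (fun x => x * f x) gam := by
    simpa [mul_comm] using ix.bdd_mul hfc.aestronglyMeasurable (ae_of_all _ fb)
  have i_xf' : Integrable (fun x => x * f' x) gam := by
    simpa [mul_comm] using ix.bdd_mul hc.aestronglyMeasurable (ae_of_all _ hB)
  have i_xxf : Integrable (fun x => x * (x * f x)) gam := by
    have := (pow_int 2).bdd_mul hfc.aestronglyMeasurable (ae_of_all _ fb)
    refine this.congr (ae_of_all _ fun x => ?_)
    simp only; ring
  -- moments of the derivative
  have m0 : ∫ x, f' x ∂gam = 0 := by rw [stein h.hd i_f i_f' i_xf, h1]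
  have m1 : ∫ x, x * f' x ∂gam = 0 := by
    have := stein (h := fun x => x * f x) (h' := fun x => f x + x * f' x)
      (fun x => ((hasDerivAt_id x).mul (h.hd x)).congr_deriv (by simp)) i_xf
      (i_f.add i_xf') i_xxf
    rw [integral_add i_f i_xf', h0] at this
    have e : ∫ x, x * (x * f x) ∂gam = 1 := by
      rw [← h2]; congr 1; ext x; ring
    linarith
  obtain ⟨A, hA, ⟨C, hC⟩, hx⟩ := exists_a hc hB m0
  obtain ⟨iq, iq2, q2, qin, qr⟩ := qq_facts hc hB hA hC hx m0 m1
  have cA : Continuous A := continuous_iff_continuousAt.2 fun x => (hA x).continuousAt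
  have cq : Continuous (qq f' A) := by unfold qq; fun_prop
  -- score
  set ψ : ℝ → ℝ := fun x => f' x / f x with hψ
  have cψ : Continuous ψ := hc.div hfc (fun x => (fp x).ne')
  have bψ : ∀ x, |ψ x| ≤ B / a := fun x => by
    rw [hψ]; simp only; rw [abs_div, abs_of_pos (fp x)]
    exact div_le_div₀ hB0 (hB x) ha (h.bd x).1
  have ψf : ∀ x, ψ x * f x = f' x := fun x => div_mul_cancel₀ _ (fp x).ne'
  have Jf : Ji f = ∫ x, ψ x * f' x ∂gam := by
    unfold Ji; rw [h.deriv_eq]; congr 1; ext x; simp only [hψ]; ring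
  have i_ψf' : Integrable (fun x => ψ x * f' x) gam := bd_int (by fun_prop) (B / a * B) fun x => by
    rw [abs_mul]; exact mul_le_mul (bψ x) (hB x) (abs_nonneg _) (by positivity)
  have Jf2 : ∫ x, f' x ^ 2 ∂gam ≤ b * Ji f := by
    rw [Jf, ← integral_const_mul]
    refine integral_mono (bd_int (by fun_prop) (B ^ 2) fun x => by
      rw [abs_pow]; exact pow_le_pow_left₀ (abs_nonneg _) (hB x) 2) (i_ψf'.const_mul b) fun x => ?_
    simp only
    have h3 : 0 ≤ ψ x * f' x := by
      rw [← ψf x]; nlinarith [mul_nonneg (sq_nonneg (ψ x)) (fp x).le]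
    calc f' x ^ 2 = f x * (ψ x * f' x) := by rw [← ψf x]; ring
      _ ≤ b * (ψ x * f' x) := mul_le_mul_of_nonneg_right (h.bd x).2 h3
  -- the convolved density
  have hF := St_nice h ha
  set F' : ℝ → ℝ := fun u => rr * ∫ v, (f' (rr * u - rr * v) * f (rr * u + rr * v)
      + f (rr * u - rr * v) * f' (rr * u + rr * v)) ∂gam with hF'
  have Fp : ∀ x, 0 < St f x := fun x => (pow_pos ha 2).trans_le (hF.bd x).1
  have cF := hF.cont
  have cF' := hF.hc
  obtain ⟨B', hB'⟩ := hF.hB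
  have hB'0 : 0 ≤ B' := (abs_nonneg _).trans (hB' 0)
  set w : ℝ → ℝ := fun x => F' x / St f x with hw
  have cw : Continuous w := cF'.div cF (fun x => (Fp x).ne')
  have bw : ∀ x, |w x| ≤ B' / a ^ 2 := fun x => by
    rw [hw]; simp only; rw [abs_div, abs_of_pos (Fp x)]
    exact div_le_div₀ hB'0 (hB' x) (pow_pos ha 2) (hF.bd x).1
  have wF : ∀ x, w x * St f x = F' x := fun x => div_mul_cancel₀ _ (Fp x).ne'
  have JF : Ji (St f) = ∫ x, w x * F' x ∂gam := by
    unfold Ji; rw [hF.deriv_eq]; congr 1; ext x; simp only [hw]; ring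
  -- functions on the plane
  set S : ℝ × ℝ → ℝ := fun p => rr * (ψ p.1 + ψ p.2) with hS
  set G : ℝ × ℝ → ℝ := fun p => f p.1 * f p.2 with hG
  have cS : Continuous S := by fun_prop
  have cG : Continuous G := by fun_prop
  have bS : ∀ p, |S p| ≤ rr * (B / a + B / a) := fun p => by
    simp only [hS]; rw [abs_mul, abs_of_pos rr_pos]
    exact mul_le_mul_of_nonneg_left ((abs_add_le _ _).trans (add_le_add (bψ _) (bψ _))) rr_pos.le
  have Gl : ∀ p, a ^ 2 ≤ G p := fun p => by
    simp only [hG]; rw [pow_two]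
    exact mul_le_mul (h.bd _).1 (h.bd _).1 ha.le (fp _).le
  have bG : ∀ p, |G p| ≤ b * b := fun p => by
    simp only [hG]; rw [abs_mul]; exact mul_le_mul (fb _) (fb _) (abs_nonneg _) bp.le
  set R : ℝ × ℝ → ℝ × ℝ := fun p => (rr * p.1 - rr * p.2, rr * p.1 + rr * p.2) with hR
  have cR : Continuous R := by fun_prop
  have Rrot : R = rot (-(π / 4)) := by ext1 p; rw [rot_r]
  have intR : ∀ H : ℝ × ℝ → ℝ, ∫ p, H (R p) ∂gam2 = ∫ p, H p ∂gam2 := fun H => by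
    rw [Rrot]; exact integral_rot _ H
  have intgR : ∀ H : ℝ × ℝ → ℝ, Integrable H gam2 → Integrable (fun p => H (R p)) gam2 :=
    fun H hH => by rw [Rrot]; exact integrable_rot.2 hH
  -- (i)
  have I1 : ∫ p, S p ^ 2 * G p ∂gam2 = Ji f := by
    have e : ∀ p, S p ^ 2 * G p = (1 / 2) * (((ψ p.1 * f' p.1) * f p.2 + f p.1 * (ψ p.2 * f' p.2))
        + 2 * (f' p.1 * f' p.2)) := fun p => by
      simp only [hS, hG]
      rw [mul_pow, rr_sq, ← ψf p.1, ← ψf p.2]; ring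
    simp only [e]
    have k1 : Integrable (fun p : ℝ × ℝ => (ψ p.1 * f' p.1) * f p.2) gam2 := i_ψf'.mul_prod i_f
    have k2 : Integrable (fun p : ℝ × ℝ => f p.1 * (ψ p.2 * f' p.2)) gam2 := i_f.mul_prod i_ψf'
    have k3 : Integrable (fun p : ℝ × ℝ => f' p.1 * f' p.2) gam2 := i_f'.mul_prod i_f'
    have k12 : Integrable (fun p : ℝ × ℝ => (ψ p.1 * f' p.1) * f p.2 +
      f p.1 * (ψ p.2 * f' p.2)) gam2 := k1.add k2
    rw [integral_const_mul, integral_add k12 (k3.const_mul 2), integral_add k1 k2,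
      integral_const_mul, integral_prod_mul (fun x => ψ x * f' x) f,
      integral_prod_mul f (fun x => ψ x * f' x), integral_prod_mul f' f', m0, h0, ← Jf]
    ring
  have iS2G : Integrable (fun p => S p ^ 2 * G p) gam2 :=
    bd_int (by fun_prop) ((rr * (B / a + B / a)) ^ 2 * (b * b)) fun p => by
      rw [abs_mul, abs_pow]
      exact mul_le_mul (pow_le_pow_left₀ (abs_nonneg _) (bS p) 2) (bG p) (abs_nonneg _)
        (by positivity)
  -- (ii)
  have iSwG : Integrable (fun p => w p.1 * (S (R p) * G (R p))) gam2 :=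
    bd_int (by fun_prop) (B' / a ^ 2 * ((rr * (B / a + B / a)) * (b * b))) fun p => by
      have := rr_pos
      rw [abs_mul, abs_mul]
      exact mul_le_mul (bw _) (mul_le_mul (bS _) (bG _) (abs_nonneg _) (by positivity))
        (by positivity) (by positivity)
  have I2 : ∫ p, w p.1 * (S (R p) * G (R p)) ∂gam2 = Ji (St f) := by
    rw [← fubini iSwG, JF]
    congr 1; ext u
    simp only [integral_const_mul]
    congr 1
    rw [hF']; simp only
    rw [← integral_const_mul]
    congr 1; ext v
    simp only [hS, hG, hR]
    rw [← ψf (rr * u - rr * v), ← ψf (rr * u + rr * v)]; ring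
  -- (iii)
  have iwG : Integrable (fun p => w p.1 ^ 2 * G (R p)) gam2 :=
    bd_int (by fun_prop) ((B' / a ^ 2) ^ 2 * (b * b)) fun p => by
      rw [abs_mul, abs_pow]
      exact mul_le_mul (pow_le_pow_left₀ (abs_nonneg _) (bw _) 2) (bG _) (abs_nonneg _)
        (by positivity)
  have I3 : ∫ p, w p.1 ^ 2 * G (R p) ∂gam2 = Ji (St f) := by
    rw [← fubini iwG, JF]
    congr 1; ext u
    simp only [integral_const_mul]
    rw [← wF u, pow_two, mul_assoc]; rfl
  -- (v)
  have iwq : Integrable (fun p => w p.1 * qq f' A (R p)) gam2 :=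
    (intgR _ iq).bdd_mul (f := fun p : ℝ × ℝ => w p.1) (by fun_prop) (ae_of_all _ fun p => bw p.1)
  have I5 : ∫ p, w p.1 * qq f' A (R p) ∂gam2 = 0 := by
    rw [← fubini iwq]
    simp only [integral_const_mul]
    simp only [hR, qr, mul_zero, integral_zero]
  -- (vi)
  have iψq : Integrable (fun p : ℝ × ℝ => ψ p.1 * qq f' A p) gam2 :=
    iq.bdd_mul (f := fun p : ℝ × ℝ => ψ p.1) (by fun_prop) (ae_of_all _ fun p => bψ p.1)
  have iψq2 : Integrable (fun p : ℝ × ℝ => ψ p.2 * qq f' A p) gam2 :=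
    iq.bdd_mul (f := fun p : ℝ × ℝ => ψ p.2) (by fun_prop) (ae_of_all _ fun p => bψ p.2)
  have E6 : ∫ p, ψ p.1 * qq f' A p ∂gam2 = Ji f := by
    rw [← fubini iψq, Jf]
    simp only [integral_const_mul, qin]
  have E7 : ∫ p, ψ p.2 * qq f' A p ∂gam2 = Ji f := by
    rw [← E6, ← integral_prod_swap]
    congr 1; ext p; simp only [qq, Prod.fst_swap, Prod.snd_swap]; ring
  have iSq : Integrable (fun p => S p * qq f' A p) gam2 :=
    iq.bdd_mul cS.aestronglyMeasurable (ae_of_all _ bS)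
  have I6 : ∫ p, S p * qq f' A p ∂gam2 = 2 * rr * Ji f := by
    have e : ∀ p, S p * qq f' A p = rr * (ψ p.1 * qq f' A p + ψ p.2 * qq f' A p) := fun p => by
      simp only [hS]; ring
    simp only [e]
    rw [integral_const_mul, integral_add iψq iψq2, E6, E7]; ring
  -- conclusion
  set l : ℝ := rr / (8 * b) with hl
  have pw : ∀ p, a ^ 2 * (2 * l * (S (R p) * qq f' A (R p)) - 2 * l * (w p.1 * qq f' A (R p))
      - l ^ 2 * qq f' A (R p) ^ 2) ≤ S (R p) ^ 2 * G (R p) - 2 * (w p.1 * (S (R p) * G (R p)))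
      + w p.1 ^ 2 * G (R p) := fun p => by
    have e1 : 2 * l * (S (R p) * qq f' A (R p)) - 2 * l * (w p.1 * qq f' A (R p))
      - l ^ 2 * qq f' A (R p) ^ 2 ≤ (S (R p) - w p.1) ^ 2 := by
      nlinarith [sq_nonneg (S (R p) - w p.1 - l * qq f' A (R p))]
    have e2 := mul_le_mul_of_nonneg_left e1 (sq_nonneg a)
    have e3 := mul_le_mul_of_nonneg_right (Gl (R p)) (sq_nonneg (S (R p) - w p.1))
    nlinarith
  have a1 : Integrable (fun p => 2 * l * (S (R p) * qq f' A (R p))) gam2 :=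
    (intgR _ iSq).const_mul _
  have a2 : Integrable (fun p => 2 * l * (w p.1 * qq f' A (R p))) gam2 := iwq.const_mul _
  have a3 : Integrable (fun p => l ^ 2 * qq f' A (R p) ^ 2) gam2 := (intgR _ iq2).const_mul _
  have a12 : Integrable (fun p => 2 * l * (S (R p) * qq f' A (R p)) -
    2 * l * (w p.1 * qq f' A (R p))) gam2 := a1.sub a2
  have c1 : Integrable (fun p => S (R p) ^ 2 * G (R p)) gam2 := intgR _ iS2G
  have c2 : Integrable (fun p => 2 * (w p.1 * (S (R p) * G (R p)))) gam2 := iSwG.const_mul 2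
  have c12 : Integrable (fun p => S (R p) ^ 2 * G (R p) - 2 * (w p.1 * (S (R p) * G (R p)))) gam2 :=
    c1.sub c2
  have a123 : Integrable (fun p => a ^ 2 * (2 * l * (S (R p) * qq f' A (R p)) -
    2 * l * (w p.1 * qq f' A (R p)) - l ^ 2 * qq f' A (R p) ^ 2)) gam2 :=
    (a12.sub a3).const_mul (a ^ 2)
  have c123 : Integrable (fun p => S (R p) ^ 2 * G (R p) - 2 * (w p.1 * (S (R p) * G (R p)))
    + w p.1 ^ 2 * G (R p)) gam2 := c12.add iwG
  have key := integral_mono a123 c123 pw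
  have r1 := intR (fun p => S p * qq f' A p)
  have r2 := intR (fun p => qq f' A p ^ 2)
  have r3 := intR (fun p => S p ^ 2 * G p)
  rw [integral_add c12 iwG, integral_sub c1 c2, integral_const_mul] at key
  have s1 : ∫ p, (2 * l * (S (R p) * qq f' A (R p)) - 2 * l * (w p.1 * qq f' A (R p))
      - l ^ 2 * qq f' A (R p) ^ 2) ∂gam2 = 2 * l * (2 * rr * Ji f)
      - l ^ 2 * ∫ p, qq f' A p ^ 2 ∂gam2 := by
    rw [integral_sub a12 a3, integral_sub a1 a2, integral_const_mul, integral_const_mul,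
      integral_const_mul, I5, r1, r2, I6]; ring
  have key2 : a ^ 2 * (2 * l * (2 * rr * Ji f) - l ^ 2 * ∫ p, qq f' A p ^ 2 ∂gam2) ≤
      Ji f - 2 * Ji (St f) + Ji (St f) := by
    rw [← s1, ← I1, ← r3]
    rw [integral_const_mul, I2, I3] at key
    rw [I1] at r3
    exact key
  have l1 : l * rr = 1 / (16 * b) := by
    rw [hl, div_mul_eq_mul_div, ← pow_two, rr_sq]; field_simp; norm_num
  have l2 : l ^ 2 * (16 * b) = 1 / (8 * b) := by
    rw [hl, div_pow, rr_sq]; field_simp; norm_num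
  have fin : 1 / (8 * b) * Ji f ≤ 2 * l * (2 * rr * Ji f) - l ^ 2 * ∫ p, qq f' A p ^ 2 ∂gam2 := by
    have t1 : 2 * l * (2 * rr * Ji f) = 4 * (1 / (16 * b)) * Ji f := by rw [← l1]; ring
    have t2 : l ^ 2 * ∫ p, qq f' A p ^ 2 ∂gam2 ≤ l ^ 2 * (16 * b) * Ji f := by
      rw [mul_assoc]
      refine mul_le_mul_of_nonneg_left (q2.trans ?_) (sq_nonneg _)
      linarith
    rw [l2] at t2
    have t3 : 4 * (1 / (16 * b)) = 2 * (1 / (8 * b)) := by field_simp; norm_num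
    rw [t1, t3]; linarith
  have := mul_le_mul_of_nonneg_left fin (sq_nonneg a)
  have t4 : a ^ 2 / (8 * b) * Ji f = a ^ 2 * (1 / (8 * b) * Ji f) := by ring
  linarith

lemma Pt_zero (f : ℝ → ℝ) : Pt 0 f = f := by
  ext x; simp [Pt]

lemma En_Pt_half {f : ℝ → ℝ} (h0 : ∫ x, f x ∂gam = 1) : En (Pt (π / 2) f) = 0 := by
  have : Pt (π / 2) f = fun _ => 1 := by ext x; simp [Pt, h0]
  rw [this]; simp [En]

lemma St_int {f : ℝ → ℝ} (hf : Measurable f) {B : ℝ} (hb : ∀ x, |f x| ≤ B)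
    (h0 : ∫ x, f x ∂gam = 1) : ∫ x, St f x ∂gam = 1 := by
  have hB0 : 0 ≤ B := (abs_nonneg _).trans (hb 0)
  have i2 : Integrable (fun p : ℝ × ℝ => f p.1 * f p.2) gam2 :=
    bd_int ((hf.comp measurable_fst).mul (hf.comp measurable_snd)).aestronglyMeasurable (B * B)
      (fun p => by rw [abs_mul]; exact mul_le_mul (hb _) (hb _) (abs_nonneg _) hB0)
  have e1 := fubini ((integrable_rot (θ := -(π / 4))).2 i2)
  have e2 := integral_rot (-(π / 4)) (fun p => f p.1 * f p.2)
  rw [integral_prod_mul, h0] at e2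
  simp only [rot_r] at e1 e2
  unfold St
  rw [e1, e2]; norm_num

lemma smooth_contract {a b : ℝ} {f f' : ℝ → ℝ} (h : Nice a b f f') (ha : 0 < a)
    (h0 : ∫ x, f x ∂gam = 1) (h1 : ∫ x, x * f x ∂gam = 0) (h2 : ∫ x, x ^ 2 * f x ∂gam = 1) :
    En (St f) ≤ (1 - a ^ 2 / (8 * b)) * En f := by
  have fp : ∀ x, 0 < f x := fun x => ha.trans_le (h.bd x).1
  have fb : ∀ x, |f x| ≤ b := fun x => by rw [abs_of_pos (fp x)]; exact (h.bd x).2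
  have hm := h.cont.measurable
  have hF := St_nice h ha
  have d1 := fun θ => (En_hasDerivAt h ha θ).const_mul (1 - a ^ 2 / (8 * b))
  have d := fun θ => (d1 θ).sub (En_hasDerivAt hF (pow_pos ha 2) θ)
  have anti := antitoneOn_of_deriv_nonpos (convex_Icc 0 (π / 2))
    (f := (fun θ => (1 - a ^ 2 / (8 * b)) * En (Pt θ f)) - fun θ => En (Pt θ (St f)))
    (fun θ _ => (d θ).continuousAt.continuousWithinAt)
    (fun θ _ => (d θ).differentiableAt.differentiableWithinAt) (fun θ hθ => ?_)
  · have hpi := pi_pos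
    have := anti (left_mem_Icc.2 (by positivity)) (right_mem_Icc.2 (by positivity))
      (by positivity : (0:ℝ) ≤ π / 2)
    simp only [Pi.sub_apply, Pt_zero, En_Pt_half h0, En_Pt_half (St_int hm fb h0)] at this
    linarith
  · rw [(d θ).deriv]
    rw [interior_Icc] at hθ
    have hcos : 0 < cos θ := cos_pos_of_mem_Ioo ⟨by linarith [hθ.1, pi_pos], hθ.2⟩
    have hsin : 0 < sin θ := sin_pos_of_mem_Ioo ⟨hθ.1, by linarith [hθ.2, pi_pos]⟩
    have e1 := En_deriv_eq h ha θ
    have e2 := En_deriv_eq hF (pow_pos ha 2) θ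
    obtain ⟨m0, m1, m2⟩ := Pt_moments hm fb h0 h1 h2 θ
    have fc := fisher_contract (Pt_nice h θ) ha m0 m1 m2
    rw [← Pt_St hm fb θ] at fc
    refine nonpos_of_mul_nonpos_right ?_ hcos
    rw [mul_sub, mul_left_comm, e1, e2]
    nlinarith

/-- Cameron-Martin shift on the line -/
lemma gam_shift (H : ℝ → ℝ) (c : ℝ) :
    ∫ y, H (y + c) ∂gam = exp (-c ^ 2 / 2) * ∫ z, H z * exp (c * z) ∂gam := by
  rw [integral_gam, integral_gam, ← integral_const_mul,
    ← integral_add_right_eq_self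
      (fun z => exp (-c ^ 2 / 2) * (gaussPDF z * (H z * exp (c * z)))) c]
  congr 1; ext y
  have : gaussPDF y = exp (-c ^ 2 / 2) * gaussPDF (y + c) * exp (c * (y + c)) := by
    unfold gaussPDF
    rw [show exp (-c ^ 2 / 2) * ((√(2 * π))⁻¹ * exp (-(y + c) ^ 2 / 2)) * exp (c * (y + c))
      = (√(2 * π))⁻¹ * (exp (-c ^ 2 / 2) * exp (-(y + c) ^ 2 / 2) * exp (c * (y + c))) by ring,
      ← exp_add, ← exp_add]
    congr 2; ring
  rw [this]; ring

lemma Pt_smooth {f : ℝ → ℝ} (hf : Measurable f) {a b : ℝ} (ha : 0 < a)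
    (hb : ∀ x, a ≤ f x ∧ f x ≤ b) {θ : ℝ} (hs : 0 < sin θ) :
    ∃ f', Nice a b (Pt θ f) f' := by
  have fp : ∀ x, 0 < f x := fun x => ha.trans_le (hb x).1
  have fb : ∀ x, |f x| ≤ b := fun x => by rw [abs_of_pos (fp x)]; exact (hb x).2
  have bp : 0 < b := (fp 0).trans_le (hb 0).2
  set φ : ℝ → ℝ := fun z => f (sin θ * z) with hφ
  have mφ : Measurable φ := hf.comp (by fun_prop)
  have bφ : ∀ z, |φ z| ≤ b := fun z => fb _
  set t : ℝ := cos θ / sin θ with ht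
  have eP0 : ∀ x, Pt θ f x = ∫ y, φ (y + t * x) ∂gam := fun x => by
    unfold Pt; congr 1; ext y
    simp only [hφ, ht]; congr 1; field_simp; ring
  set μ : Measure ℝ := gam.withDensity (fun z => ENNReal.ofReal (φ z)) with hμ
  have mE : Measurable (fun z => ENNReal.ofReal (φ z)) := mφ.ennreal_ofReal
  have lt : ∀ᵐ z ∂gam, ENNReal.ofReal (φ z) < ⊤ := ae_of_all _ fun z => ENNReal.ofReal_lt_top
  have tr : ∀ z, (ENNReal.ofReal (φ z)).toReal = φ z := fun z => ENNReal.toReal_ofReal (fp _).le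
  have iμ : ∀ g : ℝ → ℝ, ∫ z, g z ∂μ = ∫ z, φ z * g z ∂gam := fun g => by
    rw [hμ, integral_withDensity_eq_integral_toReal_smul mE lt]
    simp only [tr, smul_eq_mul]
  have ie : ∀ y, Integrable (fun z => φ z * exp (y * z)) gam := fun y =>
    (integrable_exp_mul_gaussianReal y).bdd_mul mφ.aestronglyMeasurable (ae_of_all _ bφ)
  have hset : integrableExpSet id μ = univ := by
    ext y
    simp only [integrableExpSet, mem_ofPred_eq, mem_univ, iff_true, id]
    rw [hμ, integrable_withDensity_iff_integrable_smul' mE lt]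
    simpa only [tr, smul_eq_mul] using ie y
  have hmem : ∀ y, y ∈ interior (integrableExpSet id μ) := fun y => by rw [hset]; simp
  have eM : ∀ y, mgf id μ y = ∫ z, φ z * exp (y * z) ∂gam := fun y => by
    unfold mgf; rw [iμ]; rfl
  have dM : ∀ y, HasDerivAt (mgf id μ) (∫ z, φ z * (z * exp (y * z)) ∂gam) y := fun y => by
    have := hasDerivAt_mgf (hmem y)
    rw [iμ] at this; exact this
  have eP : Pt θ f = fun x => exp (-(t * x) ^ 2 / 2) * mgf id μ (t * x) := by
    ext x; rw [eP0, gam_shift, eM]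
  have cM : ContDiff ℝ 1 (mgf id μ) := contDiff_iff_contDiffAt.2 fun y =>
    (analyticAt_mgf (hmem y)).contDiffAt
  have cP : ContDiff ℝ 1 (Pt θ f) := by
    rw [eP]
    exact ContDiff.mul (by fun_prop) (cM.comp (by fun_prop))
  have izM : ∀ y, Integrable (fun z => φ z * (z * exp (y * z))) gam := fun y => by
    have h1 : Integrable (fun z : ℝ => z * exp (y * z)) gam := by
      have := integrable_pow_mul_exp_of_mem_interior_integrableExpSet (X := id) (μ := gam) (v := y)
        (by rw [show integrableExpSet id gam = univ from integrableExpSet_id_gaussianReal]; simp) 1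
      simpa using this
    exact h1.bdd_mul mφ.aestronglyMeasurable (ae_of_all _ bφ)
  have dP : ∀ x, HasDerivAt (Pt θ f) (t * ∫ y, y * φ (y + t * x) ∂gam) x := fun x => by
    rw [eP]
    have dl : HasDerivAt (fun x => t * x) t x := by simpa using (hasDerivAt_id x).const_mul t
    have d1 := ((dl.pow 2).neg.div_const 2).exp
    have d2 := (dM (t * x)).comp x dl
    refine (d1.mul d2).congr_deriv ?_
    have sh := gam_shift (fun z => (z - t * x) * φ z) (t * x)
    simp only [add_sub_cancel_right] at sh
    have sp : ∫ z, (z - t * x) * φ z * exp (t * x * z) ∂gam =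
        ∫ z, φ z * (z * exp (t * x * z)) ∂gam - t * x * ∫ z, φ z * exp (t * x * z) ∂gam := by
      rw [← integral_const_mul, ← integral_sub (izM _) ((ie _).const_mul _)]
      congr 1; ext z; ring
    rw [sh, sp]
    simp only [Function.comp, eM, Pi.neg_apply, Pi.pow_apply]
    push_cast
    ring
  refine ⟨deriv (Pt θ f), fun x => (dP x).differentiableAt.hasDerivAt,
    cP.continuous_deriv le_rfl, ⟨|t| * (b * ∫ y, |y| ∂gam), fun x => ?_⟩,
    fun x => Pt_bd hf hb θ x⟩
  rw [(dP x).deriv, abs_mul]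
  refine mul_le_mul_of_nonneg_left ?_ (abs_nonneg _)
  rw [← integral_const_mul, ← norm_eq_abs]
  refine norm_integral_le_of_norm_le (f := fun y => y * φ (y + t * x)) (abs_int.const_mul b)
    (ae_of_all _ fun y => ?_)
  rw [norm_mul, norm_eq_abs, norm_eq_abs, mul_comm]
  exact mul_le_mul_of_nonneg_right (bφ _) (abs_nonneg _)

lemma general_contract {f : ℝ → ℝ} (hf : Measurable f) {a b : ℝ} (ha : 0 < a)
    (hb : ∀ x, a ≤ f x ∧ f x ≤ b) (hab : a ^ 2 / (8 * b) ≤ 1)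
    (h0 : ∫ x, f x ∂gam = 1) (h1 : ∫ x, x * f x ∂gam = 0) (h2 : ∫ x, x ^ 2 * f x ∂gam = 1) :
    En (St f) ≤ (1 - a ^ 2 / (8 * b)) * En f := by
  have fp : ∀ x, 0 < f x := fun x => ha.trans_le (hb x).1
  have fb : ∀ x, |f x| ≤ b := fun x => by rw [abs_of_pos (fp x)]; exact (hb x).2
  have lim := (En_tendsto (St_meas hf) (pow_pos ha 2) (St_bd hf ha hb)).mono_left
    (nhdsWithin_le_nhds (s := Ioi 0))
  refine le_of_tendsto lim ?_
  filter_upwards [Ioo_mem_nhdsGT pi_pos] with θ hθ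
  obtain ⟨f', hN⟩ := Pt_smooth hf ha hb (sin_pos_of_mem_Ioo hθ)
  obtain ⟨m0, m1, m2⟩ := Pt_moments hf fb h0 h1 h2 θ
  rw [Pt_St hf fb θ]
  refine (smooth_contract hN ha m0 m1 m2).trans ?_
  exact mul_le_mul_of_nonneg_left (En_jensen hf ha hb θ) (by linarith)

lemma selfConv_eq (f : ℝ → ℝ) (u : ℝ) :
    selfConv (fun x => gaussPDF x * f x) u = gaussPDF u * St f u := by
  have h2 : (0:ℝ) < √2 := by positivity
  have hs : √2 * √2 = 2 := Real.mul_self_sqrt (by norm_num)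
  unfold selfConv rescaledConvPair convDens St
  rw [integral_gam]
  set H : ℝ → ℝ := fun y => gaussPDF (√2 * u - y) * f (√2 * u - y) * (gaussPDF y * f y) with hH
  -- substitute `y = rr * u + rr * v`
  have e1 : ∫ v, H (rr * u + rr * v) = √2 * ∫ y, H y := by
    rw [Measure.integral_comp_mul_left (fun v => H (rr * u + v)) rr,
      integral_add_left_eq_self H (rr * u), abs_of_pos (inv_pos.2 rr_pos), smul_eq_mul]
    congr 1
    unfold rr; field_simp; linarith
  refine e1.symm.trans ?_
  rw [← integral_const_mul]
  congr 1; ext v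
  have e2 : √2 * u - (rr * u + rr * v) = rr * u - rr * v := by unfold rr; ring
  have e3 : gaussPDF (rr * u - rr * v) * gaussPDF (rr * u + rr * v) = gaussPDF u * gaussPDF v := by
    unfold gaussPDF
    rw [show ∀ k x y : ℝ, k * exp x * (k * exp y) = k ^ 2 * (exp x * exp y) from
      fun k x y => by ring, show ∀ k x y : ℝ, k * exp x * (k * exp y) = k ^ 2 * (exp x * exp y) from
      fun k x y => by ring, ← exp_add, ← exp_add]
    congr 2
    have : -(rr * u - rr * v) ^ 2 / 2 + -(rr * u + rr * v) ^ 2 / 2 = -(rr ^ 2 * (u ^ 2 + v ^ 2)) := by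
      ring
    rw [this, rr_sq]; ring
  simp only [hH, e2]
  linear_combination (f (rr * u - rr * v) * f (rr * u + rr * v)) * e3

lemma relEntropy_eq (f : ℝ → ℝ) : relEntropy (fun x => gaussPDF x * f x) = En f := by
  unfold relEntropy En
  rw [integral_gam]
  congr 1; ext x
  rw [mul_div_cancel_left₀ _ (gaussPDF_pos x).ne', mul_assoc]

/-- if `c₁ g ≤ ρ ≤ c₂ g` for a normalized density `ρ`, then there is
`0 < c < 1`, depending only on `c₁` and `c₂`, with `0 ≤ D(ρ⊛ρ) ≤ (1 - c) D(ρ)`. -/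
theorem relative_entropy_contraction (c₁ c₂ : ℝ)
    (hc₁ : 0 < c₁) (hc₁1 : c₁ ≤ 1) (hc₂ : 1 ≤ c₂) :
    ∃ c : ℝ, 0 < c ∧ c < 1 ∧ ∀ ρ : ℝ → ℝ,
      Measurable ρ → (∫ x, ρ x) = 1 →
      (∫ x, x * ρ x) = 0 → (∫ x, x ^ 2 * ρ x) = 1 →
      (∀ x, c₁ * gaussPDF x ≤ ρ x ∧ ρ x ≤ c₂ * gaussPDF x) →
      0 ≤ relEntropy (selfConv ρ) ∧
      relEntropy (selfConv ρ) ≤ (1 - c) * relEntropy ρ := by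
  have h8 : 0 < 8 * c₂ := by linarith
  have hlt : c₁ ^ 2 / (8 * c₂) < 1 := by
    rw [div_lt_one h8]; nlinarith
  refine ⟨c₁ ^ 2 / (8 * c₂), by positivity, hlt, fun ρ hm h0 h1 h2 hb => ?_⟩
  set f : ℝ → ℝ := fun x => ρ x / gaussPDF x with hf
  have eρ : ρ = fun x => gaussPDF x * f x := by
    ext x; simp only [hf]; rw [mul_div_cancel₀ _ (gaussPDF_pos x).ne']
  have mf : Measurable f := hm.div gaussPDF_cont.measurable
  have bf : ∀ x, c₁ ≤ f x ∧ f x ≤ c₂ := fun x =>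
    ⟨(le_div_iff₀ (gaussPDF_pos x)).2 (hb x).1, (div_le_iff₀ (gaussPDF_pos x)).2 (hb x).2⟩
  have fb : ∀ x, |f x| ≤ c₂ := fun x => by
    rw [abs_of_pos (hc₁.trans_le (bf x).1)]; exact (bf x).2
  have k : ∀ x, gaussPDF x * f x = ρ x := fun x => (congrFun eρ x).symm
  have m0 : ∫ x, f x ∂gam = 1 := by
    rw [integral_gam, ← h0]; congr 1; ext x; exact k x
  have m1 : ∫ x, x * f x ∂gam = 0 := by
    rw [integral_gam, ← h1]; congr 1; ext x; rw [← k x]; ring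
  have m2 : ∫ x, x ^ 2 * f x ∂gam = 1 := by
    rw [integral_gam, ← h2]; congr 1; ext x; rw [← k x]; ring
  have e1 : relEntropy ρ = En f := by rw [← relEntropy_eq, ← eρ]
  have e2 : relEntropy (selfConv ρ) = En (St f) := by
    rw [← relEntropy_eq, eρ]; congr 1; ext u; exact selfConv_eq f u
  rw [e1, e2]
  exact ⟨En_nonneg (St_meas mf) (pow_pos hc₁ 2) (St_bd mf hc₁ bf) (St_int mf fb m0),
    general_contract mf hc₁ bf hlt.le m0 m1 m2⟩
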